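/- arXiv:1010.0335 — 7 statements merged into one kernel-verified Lean document; each statement's English description precedes it below -/
import Mathlib

section
/- Fix an even integer p ≥ 2 and let ρ_{p,0}, …, ρ_{p,p/2} be the coefficients defined by the triangular system ρ_{p,0} = 1 and Σ_{l=0}^{j} 2^l m_{2j−2l} C(p−2l, 2j−2l) ρ_{p,l} = 0 for j = 1, …, p/2. Then for all real numbers a ≥ 0, b ≥ 0, η, ζ, if X and Y are independent centered Gaussian random variables with variances a and b respectively, one has Σ_{r=0}^{p/2} ρ_{p,r} (2 ζ² b)^r E[(η X + ζ Y)^{p−2r}] = m_p · η^p · a^{p/2}. -/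
open MeasureTheory ProbabilityTheory Finset

lemma aux_df (n : ℕ) : ((2 * n - 1).doubleFactorial : ℝ) =
    ((2 * n).factorial : ℝ) / (2 ^ n * (n.factorial : ℝ)) := by
  have h : (2 * n).factorial = (2 * n - 1).doubleFactorial * (2 ^ n * n.factorial) := by
    rcases n with _ | n
    · simp
    · have := Nat.factorial_eq_mul_doubleFactorial (2 * n + 1)
      have h2 := Nat.doubleFactorial_two_mul (n + 1)
      rw [← h2]
      have e : 2 * (n + 1) = 2 * n + 1 + 1 := by ring
      rw [e, this]
      simp [mul_comm]
  rw [h]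
  have : (n.factorial : ℝ) ≠ 0 := by positivity
  push_cast
  field_simp

lemma aux_choose (i k : ℕ) :
    ((i + k).choose i : ℝ) * ((2 * (i + k) - 1).doubleFactorial : ℝ) =
    ((2 * (i + k)).choose (2 * i) : ℝ) * ((2 * i - 1).doubleFactorial : ℝ) *
      ((2 * k - 1).doubleFactorial : ℝ) := by
  rw [aux_df, aux_df, aux_df, Nat.cast_add_choose, mul_add, Nat.cast_add_choose, pow_add]
  have h1 : (i.factorial : ℝ) ≠ 0 := by positivity
  have h2 : (k.factorial : ℝ) ≠ 0 := by positivity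
  have h3 : ((i + k).factorial : ℝ) ≠ 0 := by positivity
  have h4 : ((2 * i).factorial : ℝ) ≠ 0 := by positivity
  have h5 : ((2 * k).factorial : ℝ) ≠ 0 := by positivity
  field_simp

lemma aux_std (n : ℕ) :
    ∫ x, x ^ (2 * n) ∂(gaussianReal 0 1) = ((2 * n - 1).doubleFactorial : ℝ) := by
  rw [integral_gaussianReal_eq_integral_smul one_ne_zero]
  have h1 : (fun x : ℝ => gaussianPDFReal 0 1 x • x ^ (2 * n)) =
      fun x => (fun y : ℝ => (√(2 * Real.pi))⁻¹ *
        (y ^ (2 * n) * Real.exp (-(1 / 2) * y ^ 2))) |x| := by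
    ext x
    simp only [gaussianPDFReal_def, smul_eq_mul, sq_abs, pow_mul]
    simp
    ring_nf
  rw [h1, integral_comp_abs (f := fun y : ℝ => (√(2 * Real.pi))⁻¹ *
        (y ^ (2 * n) * Real.exp (-(1 / 2) * y ^ 2))), integral_const_mul]
  have h2 := integral_rpow_mul_exp_neg_mul_rpow (p := 2) (q := ((2 * n : ℕ) : ℝ)) (b := 1 / 2)
    (by norm_num) (by have : (0 : ℝ) ≤ ((2 * n : ℕ) : ℝ) := Nat.cast_nonneg _
                      linarith) (by norm_num)
  simp only [Real.rpow_natCast, Real.rpow_two] at h2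
  rw [h2]
  have h3 : (((2 * n : ℕ) : ℝ) + 1) / 2 = n + 1 / 2 := by push_cast; ring
  rw [neg_div, h3, Real.Gamma_nat_add_half, one_div, Real.inv_rpow (by norm_num),
    Real.rpow_neg (by norm_num), inv_inv, Real.rpow_add (by norm_num), Real.rpow_natCast,
    show ((2 : ℝ) ^ (2⁻¹ : ℝ)) = √2 by rw [Real.sqrt_eq_rpow, one_div], Real.sqrt_mul (by norm_num)]
  have h4 : √(2 : ℝ) ≠ 0 := by positivity
  have h5 : √Real.pi ≠ 0 := by positivity
  field_simp

lemma aux_moment (v : NNReal) (n : ℕ) :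
    ∫ x, x ^ (2 * n) ∂(gaussianReal 0 v) =
      ((2 * n - 1).doubleFactorial : ℝ) * (v : ℝ) ^ n := by
  have h := gaussianReal_map_const_mul (μ := 0) (v := 1) (√(v : ℝ))
  have e : NNReal.mk (√(v : ℝ) ^ 2) (sq_nonneg _) * 1 = v := by
    ext; simp
  rw [e, mul_zero] at h
  rw [← h, integral_map (by fun_prop) (by fun_prop)]
  simp only [mul_pow]
  rw [integral_const_mul, aux_std, pow_mul, Real.sq_sqrt (NNReal.coe_nonneg v), mul_comm]

lemma aux_alg (q : ℕ) (ρ : ℕ → ℝ) (hρ0 : ρ 0 = 1)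
    (hρ : ∀ j : ℕ, 1 ≤ j → j ≤ q →
      ∑ l ∈ range (j + 1),
        (2 : ℝ) ^ l * ((2 * j - 2 * l - 1).doubleFactorial : ℝ) *
          ((2 * q - 2 * l).choose (2 * j - 2 * l) : ℝ) * ρ l = 0) (A B : ℝ) :
    ∑ r ∈ range (q + 1), ρ r * (2 * B) ^ r *
      (((2 * (q - r) - 1).doubleFactorial : ℝ) * (A + B) ^ (q - r))
      = ((2 * q - 1).doubleFactorial : ℝ) * A ^ q := by
  have h1 : ∀ r ∈ range (q + 1), ρ r * (2 * B) ^ r *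
      (((2 * (q - r) - 1).doubleFactorial : ℝ) * (A + B) ^ (q - r)) =
      ∑ i ∈ range (q + 1 - r), ρ r * 2 ^ r * ((2 * i - 1).doubleFactorial : ℝ) *
        ((2 * (q - r)).choose (2 * i) : ℝ) *
        (((2 * (q - (r + i)) - 1).doubleFactorial : ℝ) * A ^ (q - (r + i)) * B ^ (r + i)) := by
    intro r hr
    have hr' : r ≤ q := by simpa [Nat.lt_succ_iff] using hr
    obtain ⟨n, rfl⟩ := Nat.exists_eq_add_of_le hr'
    have e1 : r + n - r = n := by omega
    have e2 : r + n + 1 - r = n + 1 := by omega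
    rw [e1, e2, add_comm A B, add_pow, mul_sum, mul_sum]
    refine sum_congr rfl fun i hi => ?_
    have hi' : i ≤ n := by simpa [Nat.lt_succ_iff] using hi
    obtain ⟨k, rfl⟩ := Nat.exists_eq_add_of_le hi'
    have e3 : r + (i + k) - (r + i) = k := by omega
    have e4 : i + k - i = k := by omega
    rw [e3, e4, mul_pow, pow_add]
    linear_combination (ρ r * 2 ^ r * B ^ r * B ^ i * A ^ k) * aux_choose i k
  rw [sum_congr rfl h1, ← sum_range_diag_flip (q + 1) (fun r i =>
    ρ r * 2 ^ r * ((2 * i - 1).doubleFactorial : ℝ) *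
        ((2 * (q - r)).choose (2 * i) : ℝ) *
        (((2 * (q - (r + i)) - 1).doubleFactorial : ℝ) * A ^ (q - (r + i)) * B ^ (r + i)))]
  rw [sum_eq_single_of_mem 0 (by simp)]
  · simp [hρ0]
  · intro j hj hj0
    have hj' : j ≤ q := by simpa [Nat.lt_succ_iff] using hj
    have := hρ j (by omega) hj'
    rw [← zero_mul (((2 * (q - j) - 1).doubleFactorial : ℝ) * A ^ (q - j) * B ^ j), ← this,
      sum_mul]
    refine sum_congr rfl fun l hl => ?_
    have hl' : l ≤ j := by simpa [Nat.lt_succ_iff] using hl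
    have e1 : l + (j - l) = j := by omega
    rw [e1, Nat.mul_sub, Nat.mul_sub 2 q l]
    ring

/-- Lemma 3.5, first assertion, of Jacod–Podolskij–Vetter.
For an even integer `p ≥ 2` and the coefficients `ρ` defined by the triangular system
`ρ 0 = 1`, `∑_{l=0}^{j} 2^l m_{2j-2l} C(p-2l, 2j-2l) ρ l = 0` for `1 ≤ j ≤ p/2`,
and for `X, Y` independent centered Gaussians with variances `a, b`, one has
`∑_{r=0}^{p/2} ρ r (2 ζ² b)^r E[(η X + ζ Y)^{p-2r}] = m_p η^p a^{p/2}`. -/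
theorem stmt0 (p : ℕ) (hp2 : 2 ≤ p) (hpe : Even p)
    (ρ : ℕ → ℝ) (hρ0 : ρ 0 = 1)
    (hρ : ∀ j : ℕ, 1 ≤ j → j ≤ p / 2 →
      ∑ l ∈ range (j + 1),
        (2 : ℝ) ^ l * ((2 * j - 2 * l - 1).doubleFactorial : ℝ) *
          ((p - 2 * l).choose (2 * j - 2 * l) : ℝ) * ρ l = 0)
    (a b : NNReal) (η ζ : ℝ)
    {Ω : Type*} [MeasurableSpace Ω] (μ : Measure Ω) [IsProbabilityMeasure μ]
    (X Y : Ω → ℝ)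
    (hX : μ.map X = gaussianReal 0 a)
    (hY : μ.map Y = gaussianReal 0 b)
    (hXY : IndepFun X Y μ) :
    ∑ r ∈ range (p / 2 + 1),
        ρ r * (2 * ζ ^ 2 * (b : ℝ)) ^ r *
          ∫ ω, (η * X ω + ζ * Y ω) ^ (p - 2 * r) ∂μ
      = ((p - 1).doubleFactorial : ℝ) * η ^ p * (a : ℝ) ^ (p / 2) := by
  obtain ⟨q, rfl⟩ := hpe.exists_two_nsmul
  simp only [smul_eq_mul] at *
  have hq : 2 * q / 2 = q := by omega
  rw [hq] at hρ ⊢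
  have mX : AEMeasurable X μ := AEMeasurable.of_map_ne_zero (by
    rw [hX]; exact IsProbabilityMeasure.ne_zero _)
  have mY : AEMeasurable Y μ := AEMeasurable.of_map_ne_zero (by
    rw [hY]; exact IsProbabilityMeasure.ne_zero _)
  have hX' : μ.map (fun ω => η * X ω) = gaussianReal 0 (NNReal.mk (η ^ 2) (sq_nonneg _) * a) := by
    have := gaussianReal_map_const_mul (μ := 0) (v := a) η
    rw [← hX, AEMeasurable.map_map_of_aemeasurable (by fun_prop) mX, mul_zero] at this
    exact this
  have hY' : μ.map (fun ω => ζ * Y ω) = gaussianReal 0 (NNReal.mk (ζ ^ 2) (sq_nonneg _) * b) := by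
    have := gaussianReal_map_const_mul (μ := 0) (v := b) ζ
    rw [← hY, AEMeasurable.map_map_of_aemeasurable (by fun_prop) mY, mul_zero] at this
    exact this
  have hind : IndepFun (fun ω => η * X ω) (fun ω => ζ * Y ω) μ :=
    hXY.comp (φ := fun x => η * x) (ψ := fun x => ζ * x) (by fun_prop) (by fun_prop)
  have hZ := gaussianReal_add_gaussianReal_of_indepFun hind hX' hY'
  rw [add_zero] at hZ
  have hmom : ∀ n : ℕ, ∫ ω, (η * X ω + ζ * Y ω) ^ (2 * n) ∂μ =
      ((2 * n - 1).doubleFactorial : ℝ) * (η ^ 2 * a + ζ ^ 2 * b) ^ n := by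
    intro n
    have h := aux_moment (NNReal.mk (η ^ 2) (sq_nonneg _) * a +
      NNReal.mk (ζ ^ 2) (sq_nonneg _) * b) n
    rw [← hZ, integral_map (by fun_prop) (by fun_prop)] at h
    simpa using h
  have := aux_alg q ρ hρ0 hρ (η ^ 2 * a) (ζ ^ 2 * b)
  rw [mul_pow, ← pow_mul] at this
  rw [mul_assoc (((2 * q - 1).doubleFactorial : ℝ)), ← this]
  refine sum_congr rfl fun r _ => ?_
  rw [← Nat.mul_sub, hmom, mul_assoc 2]
end

section
/- Let p ≥ 2 be an even integer, let η, ζ be real numbers, and let g_1, …, g_d be weight functions. Then the d × d matrix with entries μ̄_{2p}(g_i, g_j; η, ζ) is symmetric and positive semidefinite. -/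
open MeasureTheory ProbabilityTheory Finset

/-- A *weight function* `g` with (a.e.) derivative `g'`: `g` is continuous, vanishes outside
`[0,1]`, satisfies `g 0 = g 1 = 0`, and is piecewise `C¹` with a piecewise Lipschitz
derivative `g'`. -/
def IsWeight (g g' : ℝ → ℝ) : Prop :=
  Continuous g ∧ (∀ x, x ∉ Set.Icc (0 : ℝ) 1 → g x = 0) ∧ g 0 = 0 ∧ g 1 = 0 ∧
  (∀ x, x ∉ Set.Icc (0 : ℝ) 1 → g' x = 0) ∧
  ∃ (r : ℕ) (t : ℕ → ℝ) (L : NNReal), 0 < r ∧ t 0 = 0 ∧ t r = 1 ∧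
    (∀ i < r, t i < t (i + 1)) ∧
    ∀ i < r, (∀ x ∈ Set.Ioo (t i) (t (i + 1)), HasDerivAt g (g' x) x) ∧
      LipschitzOnWith L g' (Set.Ioo (t i) (t (i + 1)))

/-- The `4 × 4` covariance matrix `Σ_{g,h}(t)`: diagonal `∫g², ∫(g')², ∫h², ∫(h')²`,
entries `(1,3)` and `(3,1)` equal to `∫ g(s-1) h(s-t) ds`, entries `(2,4)` and `(4,2)`
equal to `∫ g'(s-1) h'(s-t) ds`, and all other entries `0`. -/
noncomputable def covMat (g gd h hd : ℝ → ℝ) (t : ℝ) : Matrix (Fin 4) (Fin 4) ℝ :=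
  !![(∫ s in (0 : ℝ)..1, g s ^ 2), 0, (∫ s : ℝ, g (s - 1) * h (s - t)), 0;
     0, (∫ s in (0 : ℝ)..1, gd s ^ 2), 0, (∫ s : ℝ, gd (s - 1) * hd (s - t));
     (∫ s : ℝ, g (s - 1) * h (s - t)), 0, (∫ s in (0 : ℝ)..1, h s ^ 2), 0;
     0, (∫ s : ℝ, gd (s - 1) * hd (s - t)), 0, (∫ s in (0 : ℝ)..1, hd s ^ 2)]

/-- `ν` is a centered Gaussian probability distribution on `ℝ⁴` with covariance matrix `S`:
every linear combination of the coordinates is a centered Gaussian with the appropriate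
variance. -/
def IsCenteredGaussianCov (ν : Measure (Fin 4 → ℝ)) (S : Matrix (Fin 4) (Fin 4) ℝ) : Prop :=
  ∀ c : Fin 4 → ℝ,
    ν.map (fun x => ∑ i, c i * x i) =
      gaussianReal 0 (∑ i, ∑ j, c i * S i j * c j).toNNReal

/-- `m_u(g; η, ζ) = E[(η X + ζ Y)^u]` for `X, Y` independent centered Gaussians with
variances `∫₀¹ g²` and `∫₀¹ (g')²`, realized on the product of the two Gaussian laws. -/
noncomputable def mOne (g gd : ℝ → ℝ) (η ζ : ℝ) (u : ℕ) : ℝ :=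
  ∫ x : ℝ × ℝ, (η * x.1 + ζ * x.2) ^ u
    ∂((gaussianReal 0 (∫ s in (0 : ℝ)..1, g s ^ 2).toNNReal).prod
        (gaussianReal 0 (∫ s in (0 : ℝ)..1, gd s ^ 2).toNNReal))

/-- `μ̄_{2p}(g, h; η, ζ) = μ_{2p}(g,h;η,ζ) - 2 μ_p(g;η,ζ) μ_p(h;η,ζ)`, where the mixed
moments `m_{u,v}(g,h;η,ζ)` are computed from the family `ν t` of centered Gaussian laws
with covariance `Σ_{g,h}(t)`, integrated over `t ∈ [0,2]`. -/
noncomputable def mubar (p : ℕ) (ρ : ℕ → ℝ) (η ζ : ℝ) (g gd h hd : ℝ → ℝ)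
    (ν : ℝ → Measure (Fin 4 → ℝ)) : ℝ :=
  (∑ r ∈ range (p / 2 + 1), ∑ r' ∈ range (p / 2 + 1),
      ρ r * ρ r' * (2 * ζ ^ 2 * ∫ s in (0 : ℝ)..1, gd s ^ 2) ^ r *
        (2 * ζ ^ 2 * ∫ s in (0 : ℝ)..1, hd s ^ 2) ^ r' *
        ∫ t in (0 : ℝ)..2,
          ∫ x, (η * x 0 + ζ * x 1) ^ (p - 2 * r) * (η * x 2 + ζ * x 3) ^ (p - 2 * r')
            ∂(ν t)) -
    2 * (∑ r ∈ range (p / 2 + 1),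
          ρ r * (2 * ζ ^ 2 * ∫ s in (0 : ℝ)..1, gd s ^ 2) ^ r *
            mOne g gd η ζ (p - 2 * r)) *
      (∑ r ∈ range (p / 2 + 1),
          ρ r * (2 * ζ ^ 2 * ∫ s in (0 : ℝ)..1, hd s ^ 2) ^ r *
            mOne h hd η ζ (p - 2 * r))

/-- Coefficients of `exp (v T² / 2)`. -/
noncomputable def ecoef (v : ℝ) (n : ℕ) : ℝ :=
  if Even n then (v / 2) ^ (n / 2) / ((n / 2).factorial : ℝ) else 0

lemma ecoef_two_mul (v : ℝ) (k : ℕ) : ecoef v (2 * k) = (v / 2) ^ k / (k.factorial : ℝ) := by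
  simp [ecoef]

lemma ecoef_odd (v : ℝ) (n : ℕ) (h : ¬ Even n) : ecoef v n = 0 := by
  simp [ecoef, h]

lemma ecoef_zero (v : ℝ) : ecoef v 0 = 1 := by simp [ecoef]

lemma ecoef_scale (a v : ℝ) (n : ℕ) : ecoef (a ^ 2 * v) n = a ^ n * ecoef v n := by
  by_cases h : Even n
  · obtain ⟨k, rfl⟩ := h
    rw [← two_mul, ecoef_two_mul, ecoef_two_mul, mul_div_assoc, mul_pow, ← pow_mul]
    ring
  · simp [ecoef_odd _ _ h]

lemma sum_antidiag_even (f : ℕ → ℕ → ℝ) (M : ℕ)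
    (hf : ∀ i j, ¬ Even i → f i j = 0) :
    ∑ x ∈ antidiagonal (2 * M), f x.1 x.2 = ∑ x ∈ antidiagonal M, f (2 * x.1) (2 * x.2) := by
  symm
  apply Finset.sum_of_injOn (fun x : ℕ × ℕ => (2 * x.1, 2 * x.2))
  · rintro ⟨a, b⟩ _ ⟨c, d⟩ _ h
    simp only [Prod.mk.injEq] at h ⊢
    omega
  · rintro ⟨a, b⟩ h
    simp only [mem_coe, HasAntidiagonal.mem_antidiagonal] at h ⊢
    omega
  · rintro ⟨a, b⟩ h h2
    apply hf
    rintro ⟨k, hk⟩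
    apply h2
    simp only [HasAntidiagonal.mem_antidiagonal] at h
    refine ⟨(k, b / 2), ?_, ?_⟩
    · simp only [mem_coe, HasAntidiagonal.mem_antidiagonal]; simp only at hk; omega
    · simp only [Prod.mk.injEq]; simp only at hk; omega
  · intros; rfl

lemma ecoef_add (v w : ℝ) (n : ℕ) :
    ecoef (v + w) n = ∑ x ∈ antidiagonal n, ecoef v x.1 * ecoef w x.2 := by
  by_cases h : Even n
  · obtain ⟨M, rfl⟩ := h
    rw [← two_mul, sum_antidiag_even (fun i j => ecoef v i * ecoef w j) M
      (fun i j hi => by simp [ecoef_odd _ _ hi])]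
    simp only [ecoef_two_mul]
    rw [add_div, Finset.Nat.sum_antidiagonal_eq_sum_range_succ_mk, add_pow, Finset.sum_div]
    refine Finset.sum_congr rfl fun k hk => ?_
    have hk' : k ≤ M := by simpa [Nat.lt_succ_iff] using hk
    rw [Nat.cast_choose ℝ hk']
    have := Nat.factorial_ne_zero M
    have := Nat.factorial_ne_zero k
    have := Nat.factorial_ne_zero (M - k)
    field_simp
  · rw [ecoef_odd _ _ h]
    symm
    refine Finset.sum_eq_zero fun x hx => ?_
    rw [HasAntidiagonal.mem_antidiagonal] at hx
    by_cases h1 : Even x.1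
    · have : ¬ Even x.2 := fun h2 => h (hx ▸ h1.add h2)
      simp [ecoef_odd _ _ this]
    · simp [ecoef_odd _ _ h1]

/-- Scaled Hermite-type coefficients. -/
noncomputable def hcoef (v : ℝ) (u k : ℕ) : ℝ :=
  if k ≤ u then (u.factorial : ℝ) * ecoef v (u - k) else 0

lemma ecoef_expand (v w y : ℝ) (N K : ℕ) (hK : N ≤ 2 * K) :
    ecoef (v + w + 2 * y) N = ∑ x ∈ antidiagonal N, ∑ k ∈ range (K + 1),
      if k ≤ x.1 ∧ k ≤ x.2 then y ^ k / (k.factorial : ℝ) * ecoef v (x.1 - k) * ecoef w (x.2 - k)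
      else 0 := by
  rw [add_comm, ecoef_add]
  simp_rw [ecoef_add v w, Finset.mul_sum]
  rw [Finset.sum_sigma' (antidiagonal N), Finset.sum_sigma' (antidiagonal N)]
  symm
  rw [← Finset.sum_filter_of_ne (p := fun z : (_ : ℕ × ℕ) × ℕ => z.2 ≤ z.1.1 ∧ z.2 ≤ z.1.2)
    (by intro z _ h; by_contra h2; exact h (if_neg h2))]
  rw [← Finset.sum_filter_of_ne (s := (antidiagonal N).sigma _)
    (p := fun z : (_ : ℕ × ℕ) × (ℕ × ℕ) => Even z.1.1)
    (by intro z _ h; by_contra h2; exact h (by simp [ecoef_odd _ _ h2]))]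
  refine Finset.sum_nbij' (fun z => ⟨(2 * z.2, N - 2 * z.2), (z.1.1 - z.2, z.1.2 - z.2)⟩)
    (fun z => ⟨(z.2.1 + z.1.1 / 2, z.2.2 + z.1.1 / 2), z.1.1 / 2⟩) ?_ ?_ ?_ ?_ ?_
  · rintro ⟨⟨a, b⟩, k⟩ h
    simp at h ⊢
    omega
  · rintro ⟨⟨a, b⟩, ⟨c, d⟩⟩ h
    simp [Nat.even_iff] at h ⊢
    omega
  · rintro ⟨⟨a, b⟩, k⟩ h
    simp at h ⊢
    omega
  · rintro ⟨⟨a, b⟩, ⟨c, d⟩⟩ h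
    simp [Nat.even_iff] at h ⊢
    omega
  · rintro ⟨⟨a, b⟩, k⟩ h
    simp only [Finset.mem_filter, Finset.mem_sigma] at h
    simp only [h.2, and_self, if_true, ecoef_two_mul]
    rw [mul_div_cancel_left₀ y (two_ne_zero)]
    ring

lemma integrable_pow_gaussian (v : NNReal) (n : ℕ) :
    Integrable (fun x : ℝ => x ^ n) (gaussianReal 0 v) := by
  have h := (memLp_id_gaussianReal (μ := 0) (v := v) (n : NNReal))
  have := h.integrable_norm_pow'
  refine (integrable_norm_iff (by fun_prop)).1 ?_
  simpa [norm_pow] using this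

lemma gaussian_rec (v : NNReal) (n : ℕ) :
    ∫ x : ℝ, x ^ (n + 2) ∂(gaussianReal 0 v) = (n + 1) * v * ∫ x : ℝ, x ^ n ∂(gaussianReal 0 v) := by
  by_cases hv : v = 0
  · subst hv; simp
  have hv0 : (v : ℝ) ≠ 0 := by exact_mod_cast hv
  have hinteg : ∀ k : ℕ, Integrable (fun x : ℝ => x ^ k * gaussianPDFReal 0 v x) := by
    intro k
    have h := integrable_pow_gaussian v k
    rw [gaussianReal_of_var_ne_zero _ hv, integrable_withDensity_iff (measurable_gaussianPDF _ _)
      (by simp [gaussianPDF_lt_top])] at h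
    simpa [toReal_gaussianPDF] using h
  rw [integral_gaussianReal_eq_integral_smul hv, integral_gaussianReal_eq_integral_smul hv]
  have hd : ∀ x, HasDerivAt (gaussianPDFReal 0 v) (-(x / v) * gaussianPDFReal 0 v x) x := by
    intro x
    rw [gaussianPDFReal_def]
    have h1 : HasDerivAt (fun x : ℝ => -(x - 0) ^ 2 / (2 * (v : ℝ))) (-(x / v)) x := by
      have := (((hasDerivAt_id x).sub_const 0).pow 2).neg.div_const (2 * (v : ℝ))
      refine this.congr_deriv ?_
      simp only [id, sub_zero]
      field_simp
      simp
    refine (h1.exp.const_mul (√(2 * Real.pi * v))⁻¹).congr_deriv ?_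
    ring
  have key := integral_mul_deriv_eq_deriv_mul_of_integrable
    (u := fun x : ℝ => x ^ (n + 1)) (v := gaussianPDFReal 0 v)
    (u' := fun x : ℝ => ((n + 1 : ℕ) : ℝ) * x ^ n) (v' := fun x => -(x / v) * gaussianPDFReal 0 v x)
    (fun x _ => by simpa using hasDerivAt_pow (n + 1) x) (fun x _ => hd x)
    (by
      refine ((hinteg (n + 2)).const_mul (-(1 / (v : ℝ)))).congr (ae_of_all _ fun x => ?_)
      simp only [Pi.mul_apply]; ring)
    (by
      refine ((hinteg n).const_mul ((n + 1 : ℕ) : ℝ)).congr (ae_of_all _ fun x => ?_)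
      simp only [Pi.mul_apply]; ring)
    (hinteg (n + 1))
  have e1 : ∀ x : ℝ, x ^ (n + 1) * (-(x / v) * gaussianPDFReal 0 v x)
      = -(1 / (v : ℝ)) * (gaussianPDFReal 0 v x * x ^ (n + 2)) := by intro x; ring
  have e2 : ∀ x : ℝ, ((n + 1 : ℕ) : ℝ) * x ^ n * gaussianPDFReal 0 v x
      = ((n : ℝ) + 1) * (gaussianPDFReal 0 v x * x ^ n) := by intro x; push_cast; ring
  simp only [e1, e2, integral_const_mul, smul_eq_mul] at key ⊢
  field_simp at key
  linarith

lemma gaussian_moment (v : NNReal) (n : ℕ) :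
    ∫ x : ℝ, x ^ n ∂(gaussianReal 0 v) = (n.factorial : ℝ) * ecoef v n := by
  induction n using Nat.twoStepInduction with
  | zero => simp [ecoef_zero]
  | one => simp [ecoef_odd]
  | more n ih _ =>
    rw [gaussian_rec, ih]
    by_cases h : Even n
    · obtain ⟨k, rfl⟩ := h
      have h2 : k + k + 2 = 2 * (k + 1) := by ring
      rw [h2, ecoef_two_mul, ← two_mul, ecoef_two_mul, show 2 * (k + 1) = 2 * k + 1 + 1 by ring]
      simp only [Nat.factorial_succ]
      push_cast
      have := Nat.factorial_ne_zero k
      field_simp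
      ring
    · have h2 : ¬ Even (n + 2) := by simpa [Nat.even_add] using h
      simp [ecoef_odd _ _ h, ecoef_odd _ _ h2]

lemma coeff_ext (f g : ℕ → ℝ) (N : ℕ)
    (h : ∀ a : ℝ, ∑ i ∈ range (N + 1), f i * a ^ i = ∑ i ∈ range (N + 1), g i * a ^ i)
    (i : ℕ) (hi : i ≤ N) : f i = g i := by
  have hp : (∑ i ∈ range (N + 1), Polynomial.C (f i) * Polynomial.X ^ i) =
      ∑ i ∈ range (N + 1), Polynomial.C (g i) * Polynomial.X ^ i := by
    apply Polynomial.funext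
    intro a
    simpa [Polynomial.eval_finsetSum] using h a
  have := congrArg (fun q => Polynomial.coeff q i) hp
  simpa [Polynomial.finsetSum_coeff, Polynomial.coeff_C_mul, Polynomial.coeff_X_pow,
    Nat.lt_succ_iff, hi] using this

lemma biv_integrable {Ω : Type*} [MeasurableSpace Ω] (P : Measure Ω) (U V : Ω → ℝ)
    (hU : Measurable U) (hV : Measurable V) (s w : NNReal)
    (h1 : P.map U = gaussianReal 0 s) (h2 : P.map V = gaussianReal 0 w) (m n : ℕ) :
    Integrable (fun x => U x ^ m * V x ^ n) P := by
  have i1 : Integrable (fun x => U x ^ (2 * m)) P := by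
    have := integrable_pow_gaussian s (2 * m)
    rw [← h1] at this
    exact this.comp_measurable hU
  have i2 : Integrable (fun x => V x ^ (2 * n)) P := by
    have := integrable_pow_gaussian w (2 * n)
    rw [← h2] at this
    exact this.comp_measurable hV
  refine (i1.add i2).mono' (by fun_prop) (ae_of_all _ fun x => ?_)
  simp only [Pi.add_apply, Real.norm_eq_abs, pow_mul', abs_mul]
  rw [← sq_abs (U x ^ m), ← sq_abs (V x ^ n)]
  nlinarith [sq_nonneg (|U x ^ m| - |V x ^ n|), sq_nonneg (|U x ^ m|), sq_nonneg (|V x ^ n|)]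

lemma biv_moment {Ω : Type*} [MeasurableSpace Ω] (P : Measure Ω) (U V : Ω → ℝ)
    (hU : Measurable U) (hV : Measurable V) (s w c : ℝ)
    (hq : ∀ a b : ℝ, 0 ≤ a ^ 2 * s + b ^ 2 * w + 2 * (a * b * c))
    (hlaw : ∀ a b : ℝ, P.map (fun x => a * U x + b * V x) =
      gaussianReal 0 (a ^ 2 * s + b ^ 2 * w + 2 * (a * b * c)).toNNReal)
    (m n K : ℕ) (hK : m + n ≤ 2 * K) :
    ∫ x, U x ^ m * V x ^ n ∂P =
      ∑ k ∈ range (K + 1), 1 / (k.factorial : ℝ) * hcoef s m k * hcoef w n k * c ^ k := by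
  have hinteg : ∀ m n : ℕ, Integrable (fun x => U x ^ m * V x ^ n) P :=
    biv_integrable P U V hU hV _ _ (by simpa using hlaw 1 0) (by simpa using hlaw 0 1)
  have key : ∀ a : ℝ,
      ∑ i ∈ range (m + n + 1), (((m + n).choose i : ℝ) * ∫ x, U x ^ i * V x ^ (m + n - i) ∂P) * a ^ i
      = ∑ i ∈ range (m + n + 1), (((m + n).factorial : ℝ) * ∑ k ∈ range (K + 1),
        if k ≤ i ∧ k ≤ m + n - i then c ^ k / (k.factorial : ℝ) * ecoef s (i - k) *
          ecoef w (m + n - i - k) else 0) * a ^ i := by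
    intro a
    have l1 : ∫ x, (a * U x + 1 * V x) ^ (m + n) ∂P =
        ((m + n).factorial : ℝ) * ecoef (a ^ 2 * s + w + 2 * (a * c)) (m + n) := by
      have h := gaussian_moment (a ^ 2 * s + 1 ^ 2 * w + 2 * (a * 1 * c)).toNNReal (m + n)
      rw [← hlaw a 1, integral_map (by fun_prop) (by fun_prop), Real.coe_toNNReal _ (hq a 1)] at h
      simpa using h
    have l2 : ∫ x, (a * U x + 1 * V x) ^ (m + n) ∂P =
      ∑ i ∈ range (m + n + 1),
        (((m + n).choose i : ℝ) * ∫ x, U x ^ i * V x ^ (m + n - i) ∂P) * a ^ i := by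
      simp_rw [add_pow]
      rw [integral_finsetSum]
      · refine Finset.sum_congr rfl fun i _ => ?_
        rw [← integral_const_mul, ← integral_mul_const]
        refine integral_congr_ae (ae_of_all _ fun x => ?_)
        simp only [one_mul, mul_pow]
        ring
      · intro i _
        refine (((hinteg i (m + n - i)).const_mul ((m + n).choose i : ℝ)).mul_const (a ^ i)).congr
          (ae_of_all _ fun x => ?_)
        simp only [one_mul, mul_pow]
        ring
    rw [← l2, l1, ecoef_expand _ _ _ _ K hK, Finset.Nat.sum_antidiagonal_eq_sum_range_succ_mk,
      Finset.mul_sum]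
    refine Finset.sum_congr rfl fun i _ => ?_
    rw [mul_assoc, Finset.sum_mul]
    congr 1
    refine Finset.sum_congr rfl fun k _ => ?_
    by_cases h : k ≤ i ∧ k ≤ m + n - i
    · simp only [h, and_self, if_true]
      rw [ecoef_scale, mul_pow]
      have : a ^ i = a ^ k * a ^ (i - k) := by rw [← pow_add]; congr 1; omega
      rw [this]; ring
    · simp only [h, if_false, zero_mul]
  have := coeff_ext _ _ _ key m (Nat.le_add_right m n)
  rw [Nat.add_sub_cancel_left, Nat.cast_choose ℝ (Nat.le_add_right m n),
    Nat.add_sub_cancel_left] at this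
  have f1 : (m.factorial : ℝ) ≠ 0 := by exact_mod_cast Nat.factorial_ne_zero m
  have f2 : (n.factorial : ℝ) ≠ 0 := by exact_mod_cast Nat.factorial_ne_zero n
  have f3 : ((m + n).factorial : ℝ) ≠ 0 := by exact_mod_cast Nat.factorial_ne_zero (m + n)
  have e : ∫ x, U x ^ m * V x ^ n ∂P = (m.factorial : ℝ) * n.factorial * ∑ k ∈ range (K + 1),
        if k ≤ m ∧ k ≤ n then c ^ k / (k.factorial : ℝ) * ecoef s (m - k) *
          ecoef w (n - k) else 0 := by
    field_simp at this
    rw [this]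
    congr 1
    refine Finset.sum_congr rfl fun k _ => ?_
    split_ifs <;> ring
  rw [e, Finset.mul_sum]
  refine Finset.sum_congr rfl fun k _ => ?_
  unfold hcoef
  by_cases h1 : k ≤ m <;> by_cases h2 : k ≤ n <;> simp [h1, h2]
  ring

lemma mOne_eq (g gd : ℝ → ℝ) (η ζ : ℝ) (u : ℕ) :
    mOne g gd η ζ u = hcoef (η ^ 2 * (∫ s in (0 : ℝ)..1, g s ^ 2) +
      ζ ^ 2 * (∫ s in (0 : ℝ)..1, gd s ^ 2)) u 0 := by
  have hA : 0 ≤ ∫ s in (0 : ℝ)..1, g s ^ 2 :=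
    intervalIntegral.integral_nonneg (by norm_num) fun _ _ => sq_nonneg _
  have hB : 0 ≤ ∫ s in (0 : ℝ)..1, gd s ^ 2 :=
    intervalIntegral.integral_nonneg (by norm_num) fun _ _ => sq_nonneg _
  unfold mOne
  set A := ∫ s in (0 : ℝ)..1, g s ^ 2
  set B := ∫ s in (0 : ℝ)..1, gd s ^ 2
  simp_rw [add_pow, mul_pow]
  have hi : ∀ i j : ℕ, Integrable (fun x : ℝ × ℝ => x.1 ^ i * x.2 ^ j)
      ((gaussianReal 0 A.toNNReal).prod (gaussianReal 0 B.toNNReal)) := fun i j =>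
    (integrable_pow_gaussian _ i).mul_prod (integrable_pow_gaussian _ j)
  have hv : ∀ i j : ℕ, ∫ x : ℝ × ℝ, x.1 ^ i * x.2 ^ j
      ∂((gaussianReal 0 A.toNNReal).prod (gaussianReal 0 B.toNNReal)) =
      (i.factorial * ecoef A i) * (j.factorial * ecoef B j) := fun i j => by
    rw [integral_prod_mul (fun x : ℝ => x ^ i) (fun x : ℝ => x ^ j), gaussian_moment,
      gaussian_moment, Real.coe_toNNReal _ hA, Real.coe_toNNReal _ hB]
  have hr : ∀ i : ℕ, (fun x : ℝ × ℝ => η ^ i * x.1 ^ i * (ζ ^ (u - i) * x.2 ^ (u - i)) *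
      (u.choose i : ℝ)) = fun x => (η ^ i * ζ ^ (u - i) * (u.choose i : ℝ)) *
        (x.1 ^ i * x.2 ^ (u - i)) := fun i => by funext x; ring
  rw [integral_finsetSum]
  · simp_rw [hr, integral_const_mul, hv]
    unfold hcoef
    rw [if_pos (Nat.zero_le _), Nat.sub_zero, ecoef_add,
      Finset.Nat.sum_antidiagonal_eq_sum_range_succ_mk, Finset.mul_sum]
    refine Finset.sum_congr rfl fun i hi => ?_
    have hi' : i ≤ u := by simpa [Nat.lt_succ_iff] using hi
    rw [ecoef_scale, ecoef_scale, Nat.cast_choose ℝ hi']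
    have := Nat.factorial_ne_zero i
    have := Nat.factorial_ne_zero (u - i)
    field_simp
  · intro i _
    rw [hr]
    exact (hi _ _).const_mul _

/-- Bounded measurable functions. -/
def MB {α : Type*} [MeasurableSpace α] (f : α → ℝ) : Prop :=
  Measurable f ∧ ∃ C, ∀ x, |f x| ≤ C

namespace MB

variable {α β : Type*} [MeasurableSpace α] [MeasurableSpace β]

lemma const (c : ℝ) : MB (fun _ : α => c) := ⟨measurable_const, |c|, fun _ => le_rfl⟩

lemma add {f h : α → ℝ} (hf : MB f) (hh : MB h) : MB (fun x => f x + h x) := by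
  obtain ⟨m1, C1, b1⟩ := hf
  obtain ⟨m2, C2, b2⟩ := hh
  exact ⟨m1.add m2, C1 + C2, fun x => (abs_add_le _ _).trans (add_le_add (b1 x) (b2 x))⟩

lemma mul {f h : α → ℝ} (hf : MB f) (hh : MB h) : MB (fun x => f x * h x) := by
  obtain ⟨m1, C1, b1⟩ := hf
  obtain ⟨m2, C2, b2⟩ := hh
  refine ⟨m1.mul m2, C1 * C2, fun x => ?_⟩
  rw [abs_mul]
  exact mul_le_mul (b1 x) (b2 x) (abs_nonneg _) ((abs_nonneg _).trans (b1 x))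

lemma pow {f : α → ℝ} (hf : MB f) (k : ℕ) : MB (fun x => f x ^ k) := by
  induction k with
  | zero => simpa using const 1
  | succ k ih => simpa only [pow_succ] using ih.mul hf

lemma sum {ι : Type*} (s : Finset ι) {f : ι → α → ℝ} (hf : ∀ i, MB (f i)) :
    MB (fun x => ∑ i ∈ s, f i x) := by
  classical
  induction s using Finset.induction_on with
  | empty => simpa using const 0
  | insert a s ha ih => simpa only [Finset.sum_insert ha] using (hf a).add ih

lemma comp {f : α → ℝ} (hf : MB f) {φ : β → α} (hφ : Measurable φ) : MB (fun x => f (φ x)) := by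
  obtain ⟨m1, C1, b1⟩ := hf
  exact ⟨m1.comp hφ, C1, fun x => b1 _⟩

lemma integrable {f : α → ℝ} (hf : MB f) (μ : Measure α) [IsFiniteMeasure μ] :
    Integrable f μ := by
  obtain ⟨m1, C1, b1⟩ := hf
  exact Integrable.of_bound m1.aestronglyMeasurable C1 (ae_of_all _ b1)

lemma integral {f : α → β → ℝ} (hf : MB (fun z : α × β => f z.1 z.2)) (κ : Measure β)
    [IsFiniteMeasure κ] : MB (fun z => ∫ x, f z x ∂κ) := by
  obtain ⟨m1, C1, b1⟩ := hf
  refine ⟨(m1.stronglyMeasurable.integral_prod_right' (ν := κ)).measurable, C1 * κ.real Set.univ,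
    fun z => ?_⟩
  exact norm_integral_le_of_norm_le_const (f := f z) (C := C1) (μ := κ)
    (ae_of_all _ fun x => b1 (z, x))

end MB

lemma psd_core {ι X S : Type*} [Fintype ι] [MeasurableSpace X] [MeasurableSpace S]
    (κ : Measure X) [IsFiniteMeasure κ] (μ : Measure S) [IsFiniteMeasure μ]
    (f1 f2 : ι → X → S → ℝ) (h1 : ∀ i, MB (fun z : X × S => f1 i z.1 z.2))
    (h2 : ∀ i, MB (fun z : X × S => f2 i z.1 z.2)) (k : ℕ) :
    ∀ φ : ι → S → ℝ, (∀ i, MB (φ i)) →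
      0 ≤ ∫ z : S × S, ∑ i, ∑ j,
        (∫ x, (f1 i x z.1 * f1 j x z.2 + f2 i x z.1 * f2 j x z.2) ∂κ) ^ k *
          (φ i z.1 * φ j z.2) ∂(μ.prod μ) := by
  have hB : ∀ i j, MB (fun w : (S × S) × X => f1 i w.2 w.1.1 * f1 j w.2 w.1.2 +
      f2 i w.2 w.1.1 * f2 j w.2 w.1.2) := fun i j =>
    (((h1 i).comp (φ := fun w : (S × S) × X => (w.2, w.1.1)) (by fun_prop)).mul
      ((h1 j).comp (φ := fun w : (S × S) × X => (w.2, w.1.2)) (by fun_prop))).add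
    (((h2 i).comp (φ := fun w : (S × S) × X => (w.2, w.1.1)) (by fun_prop)).mul
      ((h2 j).comp (φ := fun w : (S × S) × X => (w.2, w.1.2)) (by fun_prop)))
  have hK : ∀ i j, MB (fun z : S × S =>
      ∫ x, (f1 i x z.1 * f1 j x z.2 + f2 i x z.1 * f2 j x z.2) ∂κ) := fun i j =>
    MB.integral (f := fun (z : S × S) (x : X) =>
      f1 i x z.1 * f1 j x z.2 + f2 i x z.1 * f2 j x z.2) (hB i j) κ
  induction k with
  | zero =>
    intro φ hφ
    simp only [pow_zero, one_mul]
    have : ∀ z : S × S, ∑ i, ∑ j, φ i z.1 * φ j z.2 = (∑ i, φ i z.1) * (∑ i, φ i z.2) := fun z => by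
      rw [Finset.sum_mul_sum]
    simp_rw [this]
    rw [integral_prod_mul (fun s => ∑ i, φ i s) (fun s => ∑ i, φ i s)]
    exact mul_self_nonneg _
  | succ k ih =>
    intro φ hφ
    set K : ι → ι → S × S → ℝ := fun i j z =>
      ∫ x, (f1 i x z.1 * f1 j x z.2 + f2 i x z.1 * f2 j x z.2) ∂κ with hKdef
    have hφ1 : ∀ i, MB (fun w : (S × S) × X => φ i w.1.1) := fun i =>
      (hφ i).comp (φ := fun w : (S × S) × X => w.1.1) (by fun_prop)
    have hφ2 : ∀ i, MB (fun w : (S × S) × X => φ i w.1.2) := fun i =>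
      (hφ i).comp (φ := fun w : (S × S) × X => w.1.2) (by fun_prop)
    have hT : ∀ i j, MB (fun w : (S × S) × X => (K i j w.1 ^ k * (φ i w.1.1 * φ j w.1.2)) *
        (f1 i w.2 w.1.1 * f1 j w.2 w.1.2 + f2 i w.2 w.1.1 * f2 j w.2 w.1.2)) := fun i j =>
      ((((hK i j).comp (φ := fun w : (S × S) × X => w.1) (by fun_prop)).pow k).mul
        ((hφ1 i).mul (hφ2 j))).mul (hB i j)
    have hH := MB.sum Finset.univ (fun i => MB.sum Finset.univ (fun j => hT i j))
    have e1 : ∀ z : S × S, ∑ i, ∑ j, K i j z ^ (k + 1) * (φ i z.1 * φ j z.2) =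
        ∫ x, (∑ i, ∑ j, (K i j z ^ k * (φ i z.1 * φ j z.2)) *
        (f1 i x z.1 * f1 j x z.2 + f2 i x z.1 * f2 j x z.2)) ∂κ := by
      intro z
      have hs : ∀ i j, Integrable (fun x => (K i j z ^ k * (φ i z.1 * φ j z.2)) *
        (f1 i x z.1 * f1 j x z.2 + f2 i x z.1 * f2 j x z.2)) κ := fun i j =>
        ((hT i j).comp (φ := fun x : X => (z, x)) (by fun_prop)).integrable κ
      rw [integral_finsetSum _ (fun i _ => integrable_finsetSum _ (fun j _ => hs i j))]
      refine Finset.sum_congr rfl fun i _ => ?_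
      rw [integral_finsetSum _ (fun j _ => hs i j)]
      refine Finset.sum_congr rfl fun j _ => ?_
      rw [integral_const_mul, pow_succ]
      change _ = _ * K i j z
      ring
    change 0 ≤ ∫ z : S × S, ∑ i, ∑ j, K i j z ^ (k + 1) * (φ i z.1 * φ j z.2) ∂(μ.prod μ)
    simp_rw [e1]
    rw [integral_integral_swap (hH.integrable _)]
    refine integral_nonneg fun x => ?_
    have p1 := ih (fun i s => f1 i x s * φ i s) (fun i =>
      ((h1 i).comp (φ := fun s : S => (x, s)) (by fun_prop)).mul (hφ i))
    have p2 := ih (fun i s => f2 i x s * φ i s) (fun i =>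
      ((h2 i).comp (φ := fun s : S => (x, s)) (by fun_prop)).mul (hφ i))
    have hsum : ∀ f : ι → X → S → ℝ, (∀ i, MB (fun z : X × S => f i z.1 z.2)) →
        Integrable (fun z : S × S => ∑ i, ∑ j, K i j z ^ k *
          ((f i x z.1 * φ i z.1) * (f j x z.2 * φ j z.2))) (μ.prod μ) := fun f hf =>
      (MB.sum _ fun i => MB.sum _ fun j => ((hK i j).pow k).mul
        ((((hf i).comp (φ := fun z : S × S => (x, z.1)) (by fun_prop)).mul
          ((hφ i).comp (φ := fun z : S × S => z.1) (by fun_prop))).mul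
        (((hf j).comp (φ := fun z : S × S => (x, z.2)) (by fun_prop)).mul
          ((hφ j).comp (φ := fun z : S × S => z.2) (by fun_prop))))).integrable _
    have := add_nonneg p1 p2
    rw [← integral_add (hsum f1 h1) (hsum f2 h2)] at this
    refine this.trans_eq (integral_congr_ae (ae_of_all _ fun z => ?_))
    simp only [← Finset.sum_add_distrib]
    refine Finset.sum_congr rfl fun i _ => Finset.sum_congr rfl fun j _ => ?_
    ring

/-- Bounded measurable functions supported in `[0,1]`. -/
def Nice (f : ℝ → ℝ) : Prop := MB f ∧ ∀ x, x ∉ Set.Icc (0 : ℝ) 1 → f x = 0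

lemma MB.integrable_of_support {q : ℝ → ℝ} (hq : MB q) (a b : ℝ)
    (h0 : ∀ x, x ∉ Set.Icc a b → q x = 0) : Integrable q := by
  have h := hq.integrable (volume.restrict (Set.Icc a b))
  exact IntegrableOn.integrable_of_forall_notMem_eq_zero h h0

lemma integral_eq_interval {q : ℝ → ℝ} (a b : ℝ) (hab : a ≤ b)
    (h0 : ∀ x, x ∉ Set.Icc a b → q x = 0) : ∫ x, q x = ∫ x in a..b, q x := by
  rw [intervalIntegral.integral_of_le hab, ← integral_Icc_eq_integral_Ioc,
    setIntegral_eq_integral_of_forall_compl_eq_zero h0]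

lemma Nice.integrable_mul {f h : ℝ → ℝ} (hf : Nice f) (hh : Nice h) (a b : ℝ) :
    Integrable (fun s => f (s - a) * h (s - b)) := by
  refine MB.integrable_of_support ((hf.1.comp (φ := fun s => s - a) (by fun_prop)).mul
    (hh.1.comp (φ := fun s => s - b) (by fun_prop))) a (a + 1) fun x hx => ?_
  rw [hf.2, zero_mul]
  rintro ⟨h1, h2⟩
  exact hx ⟨by linarith, by linarith⟩

lemma Nice.integral_sq {f : ℝ → ℝ} (hf : Nice f) (a : ℝ) :
    ∫ s, f (s - a) * f (s - a) = ∫ s in (0 : ℝ)..1, f s ^ 2 := by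
  rw [integral_sub_right_eq_self (fun s => f s * f s) a]
  rw [integral_eq_interval 0 1 zero_le_one (fun x hx => by rw [hf.2 x hx, zero_mul])]
  simp only [sq]

lemma Nice.quad_nonneg {f h : ℝ → ℝ} (hf : Nice f) (hh : Nice h) (a b t : ℝ) :
    0 ≤ a ^ 2 * (∫ s in (0 : ℝ)..1, f s ^ 2) + b ^ 2 * (∫ s in (0 : ℝ)..1, h s ^ 2) +
      2 * (a * b * ∫ s, f (s - 1) * h (s - t)) := by
  have h1 : 0 ≤ ∫ s, (a * f (s - 1) + b * h (s - t)) ^ 2 := integral_nonneg fun s => sq_nonneg _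
  refine h1.trans_eq ?_
  rw [← hf.integral_sq 1, ← hh.integral_sq t, ← integral_const_mul, ← integral_const_mul,
    ← integral_const_mul, ← integral_const_mul, ← integral_add, ← integral_add]
  · refine integral_congr_ae (ae_of_all _ fun x => ?_)
    simp only
    ring
  · exact ((hf.integrable_mul hf 1 1).const_mul _).add ((hh.integrable_mul hh t t).const_mul _)
  · exact ((hf.integrable_mul hh 1 t).const_mul _).const_mul _
  · exact (hf.integrable_mul hf 1 1).const_mul _
  · exact (hh.integrable_mul hh t t).const_mul _

/-- The covariance of `η G₁ + ζ G₂` and `η G₃ + ζ G₄`. -/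
noncomputable def cc (η ζ : ℝ) (g gd h hd : ℝ → ℝ) (t : ℝ) : ℝ :=
  η ^ 2 * (∫ s : ℝ, g (s - 1) * h (s - t)) + ζ ^ 2 * ∫ s : ℝ, gd (s - 1) * hd (s - t)

lemma Nice.corr_MB {f h : ℝ → ℝ} (hf : Nice f) (hh : Nice h) :
    MB (fun t => ∫ s, f (s - 1) * h (s - t)) := by
  have e : ∀ t, ∫ s, f (s - 1) * h (s - t) = ∫ s in Set.Icc (1 : ℝ) 2, f (s - 1) * h (s - t) := by
    intro t
    rw [setIntegral_eq_integral_of_forall_compl_eq_zero]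
    intro x hx
    rw [hf.2, zero_mul]
    rintro ⟨h1, h2⟩
    exact hx ⟨by linarith, by linarith⟩
  simp_rw [e]
  exact MB.integral (f := fun t s => f (s - 1) * h (s - t))
    ((hf.1.comp (φ := fun z : ℝ × ℝ => z.2 - 1) (by fun_prop)).mul
      (hh.1.comp (φ := fun z : ℝ × ℝ => z.2 - z.1) (by fun_prop))) _

lemma Nice.corr_zero {f h : ℝ → ℝ} (hf : Nice f) (hh : Nice h) (t : ℝ)
    (ht : t ∉ Set.Icc (0 : ℝ) 2) : ∫ s, f (s - 1) * h (s - t) = 0 := by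
  have : ∀ s, f (s - 1) * h (s - t) = 0 := by
    intro s
    by_cases h1 : s - 1 ∈ Set.Icc (0 : ℝ) 1
    · rw [hh.2, mul_zero]
      rintro ⟨h2, h3⟩
      exact ht ⟨by linarith [h1.1], by linarith [h1.2]⟩
    · rw [hf.2 _ h1, zero_mul]
  simp [this]

lemma corr_symm (f h : ℝ → ℝ) (t : ℝ) :
    ∫ s, f (s - 1) * h (s - (2 - t)) = ∫ s, h (s - 1) * f (s - t) := by
  rw [← integral_sub_right_eq_self (fun s => f (s - 1) * h (s - (2 - t))) (t - 1)]
  refine integral_congr_ae (ae_of_all _ fun s => ?_)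
  simp only
  rw [show s - (t - 1) - 1 = s - t by ring, show s - (t - 1) - (2 - t) = s - 1 by ring, mul_comm]

lemma corr_shift (f h : ℝ → ℝ) (s t : ℝ) :
    ∫ x, f (x - s) * h (x - t) = ∫ x, f (x - 1) * h (x - (t - s + 1)) := by
  rw [← integral_sub_right_eq_self (fun x => f (x - 1) * h (x - (t - s + 1))) (s - 1)]
  refine integral_congr_ae (ae_of_all _ fun x => ?_)
  simp only
  rw [show x - (s - 1) - 1 = x - s by ring, show x - (s - 1) - (t - s + 1) = x - t by ring]

lemma avg_nonneg (q : ℝ → ℝ) (hq : MB q) (h0 : ∀ x, x ∉ Set.Icc (0 : ℝ) 2 → q x = 0)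
    (hN : ∀ N : ℝ, 2 ≤ N → 0 ≤ ∫ s in Set.Icc 0 N, ∫ t in Set.Icc 0 N, q (t - s + 1)) :
    0 ≤ ∫ t in (0 : ℝ)..2, q t := by
  have hqi : Integrable q := hq.integrable_of_support 0 2 h0
  rw [← integral_eq_interval 0 2 (by norm_num) h0]
  set I := ∫ x, q x with hI
  set D := ∫ x, |q x| with hD
  have main : ∀ N : ℝ, 2 ≤ N → 0 ≤ (N - 2) * I + 2 * D := by
    intro N hN2
    have h := hN N hN2
    set J : ℝ → ℝ := fun s => ∫ t in Set.Icc 0 N, q (t - s + 1) with hJ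
    have hJM : MB J := MB.integral (f := fun s t => q (t - s + 1))
      (hq.comp (φ := fun z : ℝ × ℝ => z.2 - z.1 + 1) (by fun_prop)) _
    have hJi : ∀ a b : ℝ, IntervalIntegrable J volume a b := fun a b =>
      ⟨hJM.integrable _, hJM.integrable _⟩
    have shift : ∀ (f : ℝ → ℝ) (s : ℝ), ∫ t, f (t - s + 1) = ∫ t, f t := by
      intro f s
      rw [← integral_sub_right_eq_self f (s - 1)]
      refine integral_congr_ae (ae_of_all _ fun t => ?_)
      simp only
      congr 1
      ring
    have hJD : ∀ s, |J s| ≤ D := by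
      intro s
      have hsi : Integrable (fun t => |q (t - s + 1)|) := by
        have := hqi.abs.comp_sub_right (s - 1)
        refine this.congr (ae_of_all _ fun t => ?_)
        simp only
        rw [show t - (s - 1) = t - s + 1 by ring]
      calc |J s| ≤ ∫ t in Set.Icc 0 N, |q (t - s + 1)| := abs_integral_le_integral_abs
        _ ≤ ∫ t, |q (t - s + 1)| :=
          setIntegral_le_integral hsi (ae_of_all _ fun t => abs_nonneg _)
        _ = D := shift (fun x => |q x|) s
    have hJI : ∀ s ∈ Set.Icc 1 (N - 1), J s = I := by
      intro s hs
      rw [hI, ← shift q s]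
      refine setIntegral_eq_integral_of_forall_compl_eq_zero fun t ht => h0 _ ?_
      rintro ⟨h1, h2⟩
      exact ht ⟨by linarith [hs.1], by linarith [hs.2]⟩
    rw [integral_Icc_eq_integral_Ioc, ← intervalIntegral.integral_of_le (by linarith),
      ← intervalIntegral.integral_add_adjacent_intervals (hJi 0 1) (hJi 1 N),
      ← intervalIntegral.integral_add_adjacent_intervals (hJi 1 (N - 1)) (hJi (N - 1) N)] at h
    have m1 : ∫ s in (1 : ℝ)..(N - 1), J s = (N - 2) * I := by
      rw [intervalIntegral.integral_congr (g := fun _ => I)]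
      · simp
        left
        ring
      · intro s hs
        rw [Set.uIcc_of_le (by linarith)] at hs
        exact hJI s hs
    have m2 : ∫ s in (0 : ℝ)..1, J s ≤ D := by
      have := intervalIntegral.norm_integral_le_of_norm_le_const (a := 0) (b := 1) (f := J) (C := D)
        (fun x _ => hJD x)
      simp only [sub_zero, abs_one, mul_one] at this
      exact (le_abs_self _).trans this
    have m3 : ∫ s in (N - 1)..N, J s ≤ D := by
      have := intervalIntegral.norm_integral_le_of_norm_le_const (a := N - 1) (b := N) (f := J)
        (C := D) (fun x _ => hJD x)
      simp only [sub_sub_cancel, abs_one, mul_one] at this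
      exact (le_abs_self _).trans this
    linarith
  by_contra hneg
  push Not at hneg
  have hD0 : 0 ≤ D := integral_nonneg fun x => abs_nonneg _
  have hN' : (2 : ℝ) ≤ 2 + (2 * D + 1) / (-I) := by
    have : 0 ≤ (2 * D + 1) / (-I) := div_nonneg (by linarith) (by linarith)
    linarith
  have h := main _ hN'
  have hI0 : I ≠ 0 := hneg.ne
  rw [show (2 + (2 * D + 1) / (-I) - 2) * I = -(2 * D + 1) by field_simp; ring] at h
  linarith

lemma cc_MB {η ζ : ℝ} {g gd h hd : ℝ → ℝ} (hg : Nice g) (hgd : Nice gd) (hh : Nice h)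
    (hhd : Nice hd) : MB (cc η ζ g gd h hd) :=
  ((MB.const _).mul (hg.corr_MB hh)).add ((MB.const _).mul (hgd.corr_MB hhd))

lemma kernel_psd {d : ℕ} (g gd : Fin d → ℝ → ℝ) (hg : ∀ i, Nice (g i)) (hgd : ∀ i, Nice (gd i))
    (η ζ : ℝ) (k : ℕ) (hk : k ≠ 0) (y : Fin d → ℝ) :
    0 ≤ ∑ i, ∑ j, (y i * y j) *
      ∫ t in (0 : ℝ)..2, cc η ζ (g i) (gd i) (g j) (gd j) t ^ k := by
  have hM : ∀ i j, MB (fun t => cc η ζ (g i) (gd i) (g j) (gd j) t ^ k * (y i * y j)) := fun i j =>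
    ((cc_MB (hg i) (hgd i) (hg j) (hgd j)).pow k).mul (MB.const _)
  have hi : ∀ i j, IntervalIntegrable
      (fun t => cc η ζ (g i) (gd i) (g j) (gd j) t ^ k * (y i * y j)) volume 0 2 := fun i j =>
    ⟨(hM i j).integrable _, (hM i j).integrable _⟩
  have key := avg_nonneg
    (fun t => ∑ i, ∑ j, cc η ζ (g i) (gd i) (g j) (gd j) t ^ k * (y i * y j))
    (MB.sum _ fun i => MB.sum _ fun j => hM i j) ?_ ?_
  · refine key.trans_eq ?_
    rw [intervalIntegral.integral_finsetSum (fun i _ => ?_)]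
    · refine Finset.sum_congr rfl fun i _ => ?_
      rw [intervalIntegral.integral_finsetSum (fun j _ => hi i j)]
      refine Finset.sum_congr rfl fun j _ => ?_
      rw [intervalIntegral.integral_mul_const, mul_comm]
    · have := MB.sum Finset.univ fun j => hM i j
      exact ⟨this.integrable _, this.integrable _⟩
  · intro x hx
    refine Finset.sum_eq_zero fun i _ => Finset.sum_eq_zero fun j _ => ?_
    simp [cc, (hg i).corr_zero (hg j) x hx, (hgd i).corr_zero (hgd j) x hx, hk]
  · intro N hN
    have hs : ∀ (f : Fin d → ℝ → ℝ) (c : ℝ), (∀ i, Nice (f i)) → ∀ i,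
        MB (fun z : ℝ × ℝ => c * f i (z.1 - z.2)) := fun f c hf i =>
      (MB.const c).mul ((hf i).1.comp (φ := fun z : ℝ × ℝ => z.1 - z.2) (by fun_prop))
    have core := psd_core (volume.restrict (Set.Icc 0 (N + 1))) (volume.restrict (Set.Icc 0 N))
      (fun i x s => η * g i (x - s)) (fun i x s => ζ * gd i (x - s)) (hs g η hg) (hs gd ζ hgd) k
      (fun i _ => y i) (fun i => MB.const _)
    have hq : MB (fun z : ℝ × ℝ => ∑ i, ∑ j,
        cc η ζ (g i) (gd i) (g j) (gd j) (z.2 - z.1 + 1) ^ k * (y i * y j)) :=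
      (MB.sum _ fun i => MB.sum _ fun j => hM i j).comp
        (φ := fun z : ℝ × ℝ => z.2 - z.1 + 1) (by fun_prop)
    rw [integral_integral (f := fun s t => ∑ i, ∑ j,
        cc η ζ (g i) (gd i) (g j) (gd j) (t - s + 1) ^ k * (y i * y j)) (hq.integrable _)]
    refine core.trans_eq ?_
    rw [Measure.prod_restrict]
    refine setIntegral_congr_fun (measurableSet_Icc.prod measurableSet_Icc) ?_
    rintro ⟨s, t⟩ ⟨hs1, ht1⟩
    simp only at hs1 ht1 ⊢
    refine Finset.sum_congr rfl fun i _ => Finset.sum_congr rfl fun j _ => ?_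
    congr 2
    unfold cc
    rw [← corr_shift, ← corr_shift, ← integral_const_mul, ← integral_const_mul, ← integral_add
      (((hg i).integrable_mul (hg j) s t).const_mul _)
      (((hgd i).integrable_mul (hgd j) s t).const_mul _)]
    rw [setIntegral_eq_integral_of_forall_compl_eq_zero]
    · refine integral_congr_ae (ae_of_all _ fun x => ?_)
      simp only
      ring
    · intro x hx
      have : x - s ∉ Set.Icc (0 : ℝ) 1 := by
        rintro ⟨h1, h2⟩
        exact hx ⟨by linarith [hs1.1], by linarith [hs1.2]⟩
      rw [(hg i).2 _ this, (hgd i).2 _ this]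
      ring

lemma partition_cover (t : ℕ → ℝ) (n : ℕ) (x : ℝ) (h0 : t 0 ≤ x) (h1 : x ≤ t n) :
    (∃ i < n, x ∈ Set.Ioo (t i) (t (i + 1))) ∨ ∃ i ≤ n, x = t i := by
  induction n with
  | zero => exact Or.inr ⟨0, le_rfl, le_antisymm h1 h0⟩
  | succ n ih =>
    rcases le_or_gt x (t n) with h | h
    · rcases ih h with ⟨i, hi, hx⟩ | ⟨i, hi, hx⟩
      · exact Or.inl ⟨i, by omega, hx⟩
      · exact Or.inr ⟨i, by omega, hx⟩
    · rcases h1.lt_or_eq with h2 | h2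
      · exact Or.inl ⟨n, by omega, h, h2⟩
      · exact Or.inr ⟨n + 1, le_rfl, h2⟩

lemma IsWeight.nice {g gd : ℝ → ℝ} (h : IsWeight g gd) : Nice g := by
  obtain ⟨hc, h0, -⟩ := h
  refine ⟨⟨hc.measurable, ?_⟩, h0⟩
  obtain ⟨C, hC⟩ := isCompact_Icc.exists_bound_of_continuousOn (hc.continuousOn (s := Set.Icc 0 1))
  refine ⟨max C 0, fun x => ?_⟩
  by_cases hx : x ∈ Set.Icc (0 : ℝ) 1
  · exact (hC x hx).trans (le_max_left _ _)
  · simp [h0 x hx]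

lemma IsWeight.nice_deriv {g gd : ℝ → ℝ} (h : IsWeight g gd) : Nice gd := by
  obtain ⟨hc, h0, -, -, hd0, r, t, L, hr, ht0, htr, hlt, hdl⟩ := h
  refine ⟨⟨?_, ?_⟩, hd0⟩
  · refine (measurable_deriv g).measurable_of_countable_ne ?_
    refine ((range (r + 1)).image t).finite_toSet.countable.mono ?_
    intro x hx
    by_contra hx2
    apply hx
    by_cases hxI : x ∈ Set.Icc (0 : ℝ) 1
    · rcases partition_cover t r x (ht0 ▸ hxI.1) (htr ▸ hxI.2) with ⟨i, hi, hxi⟩ | ⟨i, hi, hxi⟩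
      · exact ((hdl i hi).1 x hxi).deriv
      · exact absurd (by simpa using ⟨i, by omega, hxi.symm⟩) hx2
    · rw [hd0 x hxI]
      have : g =ᶠ[nhds x] fun _ => (0 : ℝ) := by
        filter_upwards [isClosed_Icc.isOpen_compl.mem_nhds hxI] with z hz
        exact h0 z hz
      rw [this.deriv_eq, deriv_const]
  · have hb : ∀ i, ∃ C : ℝ, i < r → ∀ x ∈ Set.Ioo (t i) (t (i + 1)), |gd x| ≤ C := by
      intro i
      refine ⟨|gd ((t i + t (i + 1)) / 2)| + L * (t (i + 1) - t i), fun hi x hx => ?_⟩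
      have hlt' := hlt i hi
      have := (hdl i hi).2.dist_le_mul x hx ((t i + t (i + 1)) / 2)
        ⟨by linarith, by linarith⟩
      rw [Real.dist_eq, Real.dist_eq] at this
      have h2 : |x - (t i + t (i + 1)) / 2| ≤ t (i + 1) - t i := by
        rw [abs_le]; constructor <;> linarith [hx.1, hx.2]
      have h3 := abs_sub_abs_le_abs_sub (gd x) (gd ((t i + t (i + 1)) / 2))
      have h4 := mul_le_mul_of_nonneg_left h2 L.coe_nonneg
      linarith
    choose C hC using hb
    refine ⟨∑ i ∈ range (r + 1), (|C i| + |gd (t i)|), fun x => ?_⟩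
    have hnn : ∀ i ∈ range (r + 1), 0 ≤ |C i| + |gd (t i)| := fun i _ => by positivity
    by_cases hxI : x ∈ Set.Icc (0 : ℝ) 1
    · rcases partition_cover t r x (ht0 ▸ hxI.1) (htr ▸ hxI.2) with ⟨i, hi, hxi⟩ | ⟨i, hi, hxi⟩
      · refine le_trans ?_ (Finset.single_le_sum hnn (Finset.mem_range.2 (show i < r + 1 by omega)))
        have := hC i hi x hxi
        linarith [le_abs_self (C i), abs_nonneg (gd (t i))]
      · refine le_trans ?_ (Finset.single_le_sum hnn (Finset.mem_range.2 (show i < r + 1 by omega)))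
        rw [hxi]
        linarith [abs_nonneg (C i)]
    · rw [hd0 x hxI, abs_zero]
      exact Finset.sum_nonneg hnn

/-- The coefficients of the chaos expansion. -/
noncomputable def bcoef (p : ℕ) (ρ : ℕ → ℝ) (η ζ : ℝ) (g gd : ℝ → ℝ) (k : ℕ) : ℝ :=
  ∑ r ∈ range (p / 2 + 1), ρ r * (2 * ζ ^ 2 * ∫ s in (0 : ℝ)..1, gd s ^ 2) ^ r *
    hcoef (η ^ 2 * (∫ s in (0 : ℝ)..1, g s ^ 2) + ζ ^ 2 * (∫ s in (0 : ℝ)..1, gd s ^ 2))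
      (p - 2 * r) k

lemma inner_moment {η ζ : ℝ} {g gd h hd : ℝ → ℝ} (hg : Nice g) (hgd : Nice gd) (hh : Nice h)
    (hhd : Nice hd) (t : ℝ) (ν : Measure (Fin 4 → ℝ))
    (hν : IsCenteredGaussianCov ν (covMat g gd h hd t)) (m n K : ℕ) (hK : m + n ≤ 2 * K) :
    ∫ x, (η * x 0 + ζ * x 1) ^ m * (η * x 2 + ζ * x 3) ^ n ∂ν =
      ∑ k ∈ range (K + 1), 1 / (k.factorial : ℝ) *
        hcoef (η ^ 2 * (∫ s in (0 : ℝ)..1, g s ^ 2) + ζ ^ 2 * (∫ s in (0 : ℝ)..1, gd s ^ 2)) m k *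
        hcoef (η ^ 2 * (∫ s in (0 : ℝ)..1, h s ^ 2) + ζ ^ 2 * (∫ s in (0 : ℝ)..1, hd s ^ 2)) n k *
        cc η ζ g gd h hd t ^ k := by
  refine biv_moment ν (fun x => η * x 0 + ζ * x 1) (fun x => η * x 2 + ζ * x 3) (by fun_prop)
    (by fun_prop) _ _ _ ?_ ?_ m n K hK
  · intro a b
    have q1 := hg.quad_nonneg hh (a * η) (b * η) t
    have q2 := hgd.quad_nonneg hhd (a * ζ) (b * ζ) t
    refine (add_nonneg q1 q2).trans_eq ?_
    unfold cc
    ring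
  · intro a b
    have := hν ![a * η, a * ζ, b * η, b * ζ]
    have e1 : (fun x : Fin 4 → ℝ => ∑ i, ![a * η, a * ζ, b * η, b * ζ] i * x i) =
        fun x => a * (η * x 0 + ζ * x 1) + b * (η * x 2 + ζ * x 3) := by
      funext x
      simp [Fin.sum_univ_four]
      ring
    rw [e1] at this
    rw [this]
    congr 2
    simp [Fin.sum_univ_four, covMat]
    unfold cc
    ring

lemma mubar_eq (p : ℕ) (ρ : ℕ → ℝ) {η ζ : ℝ} {g gd h hd : ℝ → ℝ} (hg : Nice g) (hgd : Nice gd)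
    (hh : Nice h) (hhd : Nice hd) (ν : ℝ → Measure (Fin 4 → ℝ))
    (hν : ∀ t ∈ Set.Icc (0 : ℝ) 2, IsCenteredGaussianCov (ν t) (covMat g gd h hd t)) :
    mubar p ρ η ζ g gd h hd ν = ∑ k ∈ range p, 1 / ((k + 1).factorial : ℝ) *
      (bcoef p ρ η ζ g gd (k + 1) * bcoef p ρ η ζ h hd (k + 1) *
        ∫ t in (0 : ℝ)..2, cc η ζ g gd h hd t ^ (k + 1)) := by
  have hinteg : ∀ k : ℕ, IntervalIntegrable (fun t => cc η ζ g gd h hd t ^ k) volume 0 2 := fun k =>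
    ⟨((cc_MB hg hgd hh hhd).pow k).integrable _, ((cc_MB hg hgd hh hhd).pow k).integrable _⟩
  have hI : ∀ r r' : ℕ, ∫ t in (0 : ℝ)..2,
          ∫ x, (η * x 0 + ζ * x 1) ^ (p - 2 * r) * (η * x 2 + ζ * x 3) ^ (p - 2 * r') ∂(ν t) =
      ∑ k ∈ range (p + 1), 1 / (k.factorial : ℝ) *
        hcoef (η ^ 2 * (∫ s in (0 : ℝ)..1, g s ^ 2) + ζ ^ 2 * (∫ s in (0 : ℝ)..1, gd s ^ 2))
          (p - 2 * r) k *
        hcoef (η ^ 2 * (∫ s in (0 : ℝ)..1, h s ^ 2) + ζ ^ 2 * (∫ s in (0 : ℝ)..1, hd s ^ 2))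
          (p - 2 * r') k *
        ∫ t in (0 : ℝ)..2, cc η ζ g gd h hd t ^ k := by
    intro r r'
    rw [intervalIntegral.integral_congr (g := fun t => ∑ k ∈ range (p + 1), 1 / (k.factorial : ℝ) *
        hcoef (η ^ 2 * (∫ s in (0 : ℝ)..1, g s ^ 2) + ζ ^ 2 * (∫ s in (0 : ℝ)..1, gd s ^ 2))
          (p - 2 * r) k *
        hcoef (η ^ 2 * (∫ s in (0 : ℝ)..1, h s ^ 2) + ζ ^ 2 * (∫ s in (0 : ℝ)..1, hd s ^ 2))
          (p - 2 * r') k * cc η ζ g gd h hd t ^ k)]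
    · rw [intervalIntegral.integral_finsetSum (fun k _ => (hinteg k).const_mul _)]
      refine Finset.sum_congr rfl fun k _ => ?_
      rw [intervalIntegral.integral_const_mul]
    · intro t ht
      rw [Set.uIcc_of_le (by norm_num)] at ht
      exact inner_moment hg hgd hh hhd t (ν t) (hν t ht) _ _ p (by omega)
  unfold mubar
  simp_rw [hI, mOne_eq]
  have e1 : ∑ r ∈ range (p / 2 + 1), ∑ r' ∈ range (p / 2 + 1),
      ρ r * ρ r' * (2 * ζ ^ 2 * ∫ s in (0 : ℝ)..1, gd s ^ 2) ^ r *
        (2 * ζ ^ 2 * ∫ s in (0 : ℝ)..1, hd s ^ 2) ^ r' *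
        ∑ k ∈ range (p + 1), 1 / (k.factorial : ℝ) *
        hcoef (η ^ 2 * (∫ s in (0 : ℝ)..1, g s ^ 2) + ζ ^ 2 * (∫ s in (0 : ℝ)..1, gd s ^ 2))
          (p - 2 * r) k *
        hcoef (η ^ 2 * (∫ s in (0 : ℝ)..1, h s ^ 2) + ζ ^ 2 * (∫ s in (0 : ℝ)..1, hd s ^ 2))
          (p - 2 * r') k *
        ∫ t in (0 : ℝ)..2, cc η ζ g gd h hd t ^ k
      = ∑ k ∈ range (p + 1), 1 / (k.factorial : ℝ) *
      (bcoef p ρ η ζ g gd k * bcoef p ρ η ζ h hd k *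
        ∫ t in (0 : ℝ)..2, cc η ζ g gd h hd t ^ k) := by
    simp_rw [Finset.mul_sum]
    rw [Finset.sum_congr rfl (fun r _ => Finset.sum_comm), Finset.sum_comm]
    refine Finset.sum_congr rfl fun k _ => ?_
    unfold bcoef
    rw [Finset.sum_mul_sum, Finset.sum_mul, Finset.mul_sum]
    refine Finset.sum_congr rfl fun r _ => ?_
    rw [Finset.sum_mul, Finset.mul_sum]
    refine Finset.sum_congr rfl fun r' _ => ?_
    ring
  rw [e1, Finset.sum_range_succ']
  have e0 : ∫ t in (0 : ℝ)..2, cc η ζ g gd h hd t ^ 0 = 2 := by simp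
  rw [e0]
  change _ - 2 * bcoef p ρ η ζ g gd 0 * bcoef p ρ η ζ h hd 0 = _
  simp only [Nat.factorial_zero, Nat.cast_one]
  ring

lemma cc_int_symm (η ζ : ℝ) (g gd h hd : ℝ → ℝ) (k : ℕ) :
    ∫ t in (0 : ℝ)..2, cc η ζ g gd h hd t ^ k = ∫ t in (0 : ℝ)..2, cc η ζ h hd g gd t ^ k := by
  have := intervalIntegral.integral_comp_sub_left (a := 0) (b := 2)
    (fun t => cc η ζ g gd h hd t ^ k) 2
  rw [sub_self, sub_zero] at this
  rw [← this]
  refine intervalIntegral.integral_congr fun t _ => ?_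
  simp only [cc, corr_symm]

/-- Lemma 3.5, second assertion, of Jacod–Podolskij–Vetter. For an even
integer `p ≥ 2`, reals `η, ζ`, and weight functions `g_1, …, g_d`, the `d × d` matrix with
entries `μ̄_{2p}(g_i, g_j; η, ζ)` is symmetric and positive semidefinite. -/
theorem stmt1 (p : ℕ) (hp2 : 2 ≤ p) (hpe : Even p)
    (ρ : ℕ → ℝ) (hρ0 : ρ 0 = 1)
    (hρ : ∀ j : ℕ, 1 ≤ j → j ≤ p / 2 →
      ∑ l ∈ range (j + 1),
        (2 : ℝ) ^ l * ((2 * j - 2 * l - 1).doubleFactorial : ℝ) *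
          ((p - 2 * l).choose (2 * j - 2 * l) : ℝ) * ρ l = 0)
    (η ζ : ℝ) (d : ℕ) (g gd : Fin d → ℝ → ℝ) (hg : ∀ i, IsWeight (g i) (gd i))
    (ν : Fin d → Fin d → ℝ → Measure (Fin 4 → ℝ))
    (hν : ∀ i j, ∀ t ∈ Set.Icc (0 : ℝ) 2, IsProbabilityMeasure (ν i j t) ∧
      IsCenteredGaussianCov (ν i j t) (covMat (g i) (gd i) (g j) (gd j) t)) :
    (Matrix.of fun i j : Fin d =>
        mubar p ρ η ζ (g i) (gd i) (g j) (gd j) (ν i j)).IsSymm ∧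
    (Matrix.of fun i j : Fin d =>
        mubar p ρ η ζ (g i) (gd i) (g j) (gd j) (ν i j)).PosSemidef := by
  have hn : ∀ i, Nice (g i) := fun i => (hg i).nice
  have hnd : ∀ i, Nice (gd i) := fun i => (hg i).nice_deriv
  have hmu : ∀ i j, mubar p ρ η ζ (g i) (gd i) (g j) (gd j) (ν i j) =
      ∑ k ∈ range p, 1 / ((k + 1).factorial : ℝ) *
      (bcoef p ρ η ζ (g i) (gd i) (k + 1) * bcoef p ρ η ζ (g j) (gd j) (k + 1) *
        ∫ t in (0 : ℝ)..2, cc η ζ (g i) (gd i) (g j) (gd j) t ^ (k + 1)) := fun i j =>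
    mubar_eq p ρ (hn i) (hnd i) (hn j) (hnd j) _ fun t ht => (hν i j t ht).2
  have hsymm : (Matrix.of fun i j : Fin d =>
        mubar p ρ η ζ (g i) (gd i) (g j) (gd j) (ν i j)).IsSymm := by
    refine Matrix.IsSymm.ext fun i j => ?_
    simp only [Matrix.of_apply, hmu]
    refine Finset.sum_congr rfl fun k _ => ?_
    rw [cc_int_symm, mul_comm (bcoef p ρ η ζ (g j) (gd j) (k + 1))]
  refine ⟨hsymm, Matrix.PosSemidef.of_dotProduct_mulVec_nonneg ?_ fun x => ?_⟩
  · rw [Matrix.IsHermitian, Matrix.conjTranspose_eq_transpose_of_trivial]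
    exact hsymm
  · have e : star x ⬝ᵥ (Matrix.of fun i j : Fin d =>
        mubar p ρ η ζ (g i) (gd i) (g j) (gd j) (ν i j)).mulVec x =
      ∑ k ∈ range p, 1 / ((k + 1).factorial : ℝ) * ∑ i, ∑ j,
        ((x i * bcoef p ρ η ζ (g i) (gd i) (k + 1)) * (x j * bcoef p ρ η ζ (g j) (gd j) (k + 1))) *
        ∫ t in (0 : ℝ)..2, cc η ζ (g i) (gd i) (g j) (gd j) t ^ (k + 1) := by
      simp only [dotProduct, Matrix.mulVec, Matrix.of_apply, hmu, star_trivial, Finset.mul_sum,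
        Finset.sum_mul]
      rw [Finset.sum_congr rfl (fun i _ => Finset.sum_comm), Finset.sum_comm]
      refine Finset.sum_congr rfl fun k _ => Finset.sum_congr rfl fun i _ =>
        Finset.sum_congr rfl fun j _ => ?_
      ring
    rw [e]
    exact Finset.sum_nonneg fun k _ => mul_nonneg (by positivity)
      (kernel_psd g gd hn hnd η ζ (k + 1) (Nat.succ_ne_zero k) _)
end

section
/- Let p > 3 be a real number and set f(x) = |x|^p, so that f is twice continuously differentiable on ℝ with f'(x) = p · sgn(x) · |x|^{p−1}. Define F(x,y) = f(x+y) − f(x) − f'(x) y, G(x,y) = f(x+y) − f(x) − f(y), and H(x,y) = F(x,y) − f(y). Then there is a constant K = K(p) such that for all real x, y: |F(x,y)| ≤ K (|y|^p + y² |x|^{p−2}), |G(x,y)| ≤ K (|x| |y|^{p−1} + |y| |x|^{p−1}), and |H(x,y)| ≤ K (|x| |y|^{p−1} + y² |x|^{p−2}). -/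
theorem aux_tangent (q : ℝ) (hq : 1 < q) (a b : ℝ) (ha : 0 ≤ a) (hb : 0 ≤ b) :
    q * b ^ (q - 1) * (a - b) ≤ a ^ q - b ^ q := by
  rcases hb.eq_or_lt with rfl | hb
  · rw [Real.zero_rpow (by linarith), Real.zero_rpow (by linarith)]
    have := Real.rpow_nonneg ha q
    simpa using this
  · have h := one_add_mul_self_le_rpow_one_add (s := a / b - 1) (p := q)
      (by have : 0 ≤ a / b := by positivity
          linarith) hq.le
    have e : 1 + (a / b - 1) = a / b := by ring
    rw [e, Real.div_rpow ha hb.le, le_div_iff₀ (by positivity)] at h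
    have e2 : b ^ q = b * b ^ (q - 1) := by
      rw [Real.rpow_sub_one hb.ne']; field_simp
    have e3 : (1 + q * (a / b - 1)) * b ^ q = b ^ q + q * b ^ (q - 1) * (a - b) := by
      rw [e2]; field_simp
    linarith

theorem aux_lip (q : ℝ) (hq : 1 < q) (a b M : ℝ) (ha : 0 ≤ a) (hb : 0 ≤ b)
    (haM : a ≤ M) (hbM : b ≤ M) :
    |a ^ q - b ^ q| ≤ q * M ^ (q - 1) * |a - b| := by
  have h1 := aux_tangent q hq a b ha hb
  have h2 := aux_tangent q hq b a hb ha
  have h3 : a ^ (q - 1) ≤ M ^ (q - 1) := Real.rpow_le_rpow ha haM (by linarith)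
  have h4 : b ^ (q - 1) ≤ M ^ (q - 1) := Real.rpow_le_rpow hb hbM (by linarith)
  have hq0 : 0 ≤ q := by linarith
  have h5 : q * a ^ (q - 1) * |a - b| ≤ q * M ^ (q - 1) * |a - b| := by gcongr
  have h6 : q * b ^ (q - 1) * |a - b| ≤ q * M ^ (q - 1) * |a - b| := by gcongr
  have n1 : 0 ≤ q * a ^ (q - 1) := by positivity
  have n2 : 0 ≤ q * b ^ (q - 1) := by positivity
  have h7 := mul_le_mul_of_nonneg_left (le_abs_self (a - b)) n1
  have h8 := mul_le_mul_of_nonneg_left (neg_abs_le (a - b)) n2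
  rw [abs_le]
  constructor <;> linarith

theorem aux_B (p : ℝ) (hp : 3 < p) (x y : ℝ) (h : |x| ≤ |y|) :
    |(|x + y| ^ p - |y| ^ p)| ≤ p * 2 ^ (p - 1) * (|x| * |y| ^ (p - 1)) := by
  have h0 := abs_add_le x y
  have h1 := aux_lip p (by linarith) |x + y| |y| (2 * |y|) (abs_nonneg _) (abs_nonneg _)
    (by linarith) (by linarith [abs_nonneg y])
  rw [Real.mul_rpow (by norm_num) (abs_nonneg _)] at h1
  have h2 : |(|x + y| - |y|)| ≤ |x| := by
    simpa using abs_abs_sub_abs_le_abs_sub (x + y) y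
  have hp0 : 0 ≤ p := by linarith
  calc _ ≤ _ := h1
    _ ≤ p * (2 ^ (p - 1) * |y| ^ (p - 1)) * |x| := by gcongr
    _ = _ := by ring

theorem aux_A (p : ℝ) (hp : 3 < p) (x y : ℝ) (h : |y| ≤ |x|) :
    |(|x + y| ^ p - |x| ^ p - p * Real.sign x * |x| ^ (p - 1) * y)| ≤
      p * ((p - 1) * 2 ^ (p - 2)) * (y ^ 2 * |x| ^ (p - 2)) := by
  have hs : Real.sign x * y = |x + y| - |x| := by
    rcases lt_trichotomy x 0 with hx | rfl | hx
    · rw [Real.sign_of_neg hx]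
      rw [abs_of_neg hx] at h ⊢
      have := abs_le.1 h
      rw [abs_of_nonpos (by linarith)]; ring
    · have : y = 0 := by simpa using h
      simp [this]
    · rw [Real.sign_of_pos hx]
      rw [abs_of_pos hx] at h ⊢
      have := abs_le.1 h
      rw [abs_of_nonneg (by linarith)]; ring
  have e : p * Real.sign x * |x| ^ (p - 1) * y = p * |x| ^ (p - 1) * (|x + y| - |x|) := by
    rw [← hs]; ring
  rw [e]
  have h0 := abs_add_le x y
  have ha := abs_nonneg (x + y)
  have hb := abs_nonneg x
  have h2 : |(|x + y| - |x|)| ≤ |y| := by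
    simpa using abs_abs_sub_abs_le_abs_sub (x + y) x
  generalize |x + y| = a at *
  have t1 := aux_tangent p (by linarith) a |x| ha hb
  have t2 := aux_tangent p (by linarith) |x| a hb ha
  have l := aux_lip (p - 1) (by linarith) a |x| (2 * |x|) ha hb (by linarith) (by linarith)
  rw [show p - 1 - 1 = p - 2 by ring, Real.mul_rpow (by norm_num) hb] at l
  rw [abs_of_nonneg (by linarith)]
  have hp0 : 0 ≤ p := by linarith
  have hp1 : 0 ≤ p - 1 := by linarith
  calc _ ≤ p * ((a ^ (p - 1) - |x| ^ (p - 1)) * (a - |x|)) := by linarith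
    _ ≤ p * (abs (a ^ (p - 1) - |x| ^ (p - 1)) * abs (a - |x|)) := by
        rw [← abs_mul]; gcongr; exact le_abs_self _
    _ ≤ p * (((p - 1) * (2 ^ (p - 2) * |x| ^ (p - 2)) * abs (a - |x|)) * abs (a - |x|)) := by gcongr
    _ ≤ p * (((p - 1) * (2 ^ (p - 2) * |x| ^ (p - 2)) * |y|) * |y|) := by gcongr
    _ = _ := by rw [← sq_abs y]; ring

theorem aux_pow (q : ℝ) (hq : 1 < q) (u : ℝ) (hu : 0 ≤ u) : u ^ q = u * u ^ (q - 1) := by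
  rcases hu.eq_or_lt with rfl | hu
  · rw [Real.zero_rpow (by linarith)]; ring
  · rw [Real.rpow_sub_one hu.ne']; field_simp



/-- inequalities (CD19) of Jacod–Podolskij–Vetter. For `p > 3` and
`f(x) = |x|^p` (so `f'(x) = p · sgn(x) · |x|^{p-1}`), setting
`F(x,y) = f(x+y) - f(x) - f'(x) y`, `G(x,y) = f(x+y) - f(x) - f(y)` and
`H(x,y) = F(x,y) - f(y)`, there is a constant `K = K(p)` with
`|F(x,y)| ≤ K (|y|^p + y² |x|^{p-2})`,
`|G(x,y)| ≤ K (|x| |y|^{p-1} + |y| |x|^{p-1})` and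
`|H(x,y)| ≤ K (|x| |y|^{p-1} + y² |x|^{p-2})`. -/
theorem stmt11 (p : ℝ) (hp : 3 < p) :
    ∃ K : ℝ, ∀ x y : ℝ,
      abs (|x + y| ^ p - |x| ^ p - p * Real.sign x * |x| ^ (p - 1) * y) ≤
          K * (|y| ^ p + y ^ 2 * |x| ^ (p - 2)) ∧
      abs (|x + y| ^ p - |x| ^ p - |y| ^ p) ≤
          K * (|x| * |y| ^ (p - 1) + |y| * |x| ^ (p - 1)) ∧
      abs (|x + y| ^ p - |x| ^ p - p * Real.sign x * |x| ^ (p - 1) * y - |y| ^ p) ≤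
          K * (|x| * |y| ^ (p - 1) + y ^ 2 * |x| ^ (p - 2)) := by
  refine ⟨p * 2 ^ (p - 1) + p * ((p - 1) * 2 ^ (p - 2)) + p + 2, fun x y => ?_⟩
  have hp0 : 0 ≤ p := by linarith
  have hp1 : 0 ≤ p - 1 := by linarith
  have hC1 : 0 ≤ p * (2:ℝ) ^ (p - 1) := by positivity
  have hC2 : 0 ≤ p * ((p - 1) * (2:ℝ) ^ (p - 2)) := by positivity
  have ex1 := aux_pow p (by linarith) |x| (abs_nonneg x)
  have ex2 := aux_pow (p - 1) (by linarith) |x| (abs_nonneg x)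
  have ey1 := aux_pow p (by linarith) |y| (abs_nonneg y)
  have ey2 := aux_pow (p - 1) (by linarith) |y| (abs_nonneg y)
  rw [show p - 1 - 1 = p - 2 by ring] at ex2 ey2
  have hU : 0 ≤ |x| ^ (p - 2) := by positivity
  have hV : 0 ≤ |y| ^ (p - 2) := by positivity
  have hu := abs_nonneg x
  have hv := abs_nonneg y
  have hy2 := sq_abs y
  rcases le_total |y| |x| with h | h
  · have hA := aux_A p hp x y h
    have hB := aux_B p hp y x h
    rw [add_comm y x] at hB
    have hVU : |y| ^ (p - 2) ≤ |x| ^ (p - 2) := Real.rpow_le_rpow hv h (by linarith)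
    generalize |x + y| ^ p - |x| ^ p - p * Real.sign x * |x| ^ (p - 1) * y = F at *
    generalize p * (2:ℝ) ^ (p - 1) = C1 at *
    generalize p * ((p - 1) * (2:ℝ) ^ (p - 2)) = C2 at *
    have k0 : 0 ≤ |y| ^ p := by positivity
    have k1 : 0 ≤ |x| * |y| ^ (p - 1) := by positivity
    have k2 : 0 ≤ |y| * |x| ^ (p - 1) := by positivity
    have k3 : 0 ≤ y ^ 2 * |x| ^ (p - 2) := by positivity
    have m1 : |y| ^ p ≤ y ^ 2 * |x| ^ (p - 2) := by
      rw [ey1, ey2, ← hy2, ← mul_assoc, ← sq]; gcongr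
    have m2 : |y| ^ p ≤ |y| * |x| ^ (p - 1) := by
      rw [ey1]; gcongr
    refine ⟨?_, ?_, ?_⟩
    · nlinarith [mul_nonneg hC1 k0, mul_nonneg hC1 k3, mul_nonneg hC2 k0, mul_nonneg hp0 k0, mul_nonneg hp0 k3]
    · have := abs_sub (|x + y| ^ p - |x| ^ p) (|y| ^ p)
      rw [abs_of_nonneg k0] at this
      nlinarith [mul_nonneg hC1 k1, mul_nonneg hC2 k1, mul_nonneg hC2 k2, mul_nonneg hp0 k1, mul_nonneg hp0 k2]
    · have := abs_sub F (|y| ^ p)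
      rw [abs_of_nonneg k0] at this
      nlinarith [mul_nonneg hC1 k1, mul_nonneg hC2 k1, mul_nonneg hC1 k3, mul_nonneg hp0 k1, mul_nonneg hp0 k3]
  · have hB := aux_B p hp x y h
    have hUV : |x| ^ (p - 2) ≤ |y| ^ (p - 2) := Real.rpow_le_rpow hu h (by linarith)
    have hs : |Real.sign x| ≤ 1 := by
      rcases Real.sign_apply_eq x with h | h | h <;> simp [h]
    have hT : |p * Real.sign x * |x| ^ (p - 1) * y| ≤ p * (|y| * |x| ^ (p - 1)) := by
      have k : 0 ≤ |x| ^ (p - 1) := by positivity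
      rw [abs_mul, abs_mul, abs_mul, abs_of_nonneg hp0, abs_of_nonneg k]
      calc _ ≤ p * 1 * |x| ^ (p - 1) * |y| := by gcongr
        _ = _ := by ring
    generalize p * Real.sign x * |x| ^ (p - 1) * y = T at *
    generalize p * (2:ℝ) ^ (p - 1) = C1 at *
    generalize p * ((p - 1) * (2:ℝ) ^ (p - 2)) = C2 at *
    have k0 : 0 ≤ |y| ^ p := by positivity
    have k0' : 0 ≤ |x| ^ p := by positivity
    have k1 : 0 ≤ |x| * |y| ^ (p - 1) := by positivity
    have k2 : 0 ≤ |y| * |x| ^ (p - 1) := by positivity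
    have k3 : 0 ≤ y ^ 2 * |x| ^ (p - 2) := by positivity
    have m1 : |x| ^ p ≤ |x| * |y| ^ (p - 1) := by
      rw [ex1]; gcongr
    have m2 : |y| * |x| ^ (p - 1) ≤ |x| * |y| ^ (p - 1) := by
      rw [ex2, ey2, mul_left_comm]; gcongr
    have m3 : |x| * |y| ^ (p - 1) ≤ |y| ^ p := by
      rw [ey1]; gcongr
    have q1 := mul_le_mul_of_nonneg_left m2 hp0
    have q2 := mul_le_mul_of_nonneg_left m3 hp0
    have q3 := mul_le_mul_of_nonneg_left m3 hC1
    have hB' := abs_le.1 hB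
    have hT' := abs_le.1 hT
    have r1 := mul_nonneg hC1 k1
    have r2 := mul_nonneg hC1 k2
    have r3 := mul_nonneg hC1 k3
    have r4 := mul_nonneg hC2 k1
    have r5 := mul_nonneg hC2 k2
    have r6 := mul_nonneg hC2 k3
    have r7 := mul_nonneg hp0 k1
    have r8 := mul_nonneg hp0 k2
    have r9 := mul_nonneg hp0 k3
    have r10 := mul_nonneg hC2 k0
    refine ⟨?_, ?_, ?_⟩ <;> rw [abs_le] <;> constructor <;> linarith
end

section
/- Let g be a weight function, p > 0 a real number, k ≥ 2 an integer, Δ > 0 and t > 0. Let x: [0, ∞) → ℝ be the right-continuous step function x(s) = Σ_{m=1}^{M} a_m 1_{[τ_m, ∞)}(s), with M ≥ 0 jumps of sizes a_m ∈ ℝ at times 0 < τ_1 < ⋯ < τ_M. Assume: kΔ < τ_1; τ_{m+1} − τ_m > kΔ for 1 ≤ m < M; τ_M ≤ t − 2kΔ; and no τ_m is an integer multiple of Δ. Then Σ_{i=0}^{⌊t/Δ⌋ − k} | Σ_{j=1}^{k−1} g(j/k) ( x((i+j)Δ) − x((i+j−1)Δ) ) |^p = ( Σ_{j=1}^{k}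 |g(j/k)|^p ) · Σ_{m=1}^{M} |a_m|^p. -/
theorem abs_sum_rpow_aux (S : Finset ℕ) (f : ℕ → ℝ) (p : ℝ) (hp : 0 < p)
    (h : ∀ m ∈ S, ∀ m' ∈ S, f m ≠ 0 → f m' ≠ 0 → m = m') :
    |∑ m ∈ S, f m| ^ p = ∑ m ∈ S, |f m| ^ p := by
  by_cases h0 : ∃ m ∈ S, f m ≠ 0
  · obtain ⟨m, hm, hf⟩ := h0
    have h1 : ∀ b ∈ S, b ≠ m → f b = 0 := by
      intro b hb hbm
      by_contra hc
      exact hbm (h b hb m hm hc hf)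
    rw [Finset.sum_eq_single_of_mem m hm h1, Finset.sum_eq_single_of_mem m hm]
    intro b hb hbm
    rw [h1 b hb hbm, abs_zero, Real.zero_rpow hp.ne']
  · push Not at h0
    rw [Finset.sum_eq_zero h0, abs_zero, Real.zero_rpow hp.ne']
    symm
    apply Finset.sum_eq_zero
    intro b hb
    rw [h0 b hb, abs_zero, Real.zero_rpow hp.ne']

/-- the exact identity of Step 4 of the proof of Theorem 3.1 of
Jacod–Podolskij–Vetter. For a right-continuous step function `x` with well-separated jumps
of sizes `a_m` at times `τ_m` (separation `> kΔ`, last jump before `t - 2kΔ`, first jump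
after `kΔ`, no jump at a multiple of `Δ`), the pre-averaged `p`-variation of `x` equals
`(∑_{j=1}^k |g(j/k)|^p) · ∑_m |a_m|^p`. -/
theorem stmt12 (g gd : ℝ → ℝ) (hg : IsWeight g gd) (p : ℝ) (hp : 0 < p)
    (k : ℕ) (hk : 2 ≤ k) (Δ t : ℝ) (hΔ : 0 < Δ) (ht : 0 < t)
    (M : ℕ) (a : ℕ → ℝ) (τ : ℕ → ℝ)
    (x : ℝ → ℝ)
    (hx : ∀ s : ℝ, x s = ∑ m ∈ Finset.Icc 1 M, if τ m ≤ s then a m else 0)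
    (hτpos : ∀ m, 1 ≤ m → m ≤ M → 0 < τ m)
    (hτmono : ∀ m, 1 ≤ m → m < M → τ m < τ (m + 1))
    (hfirst : 1 ≤ M → (k : ℝ) * Δ < τ 1)
    (hgap : ∀ m, 1 ≤ m → m < M → (k : ℝ) * Δ < τ (m + 1) - τ m)
    (hlast : 1 ≤ M → τ M ≤ t - 2 * k * Δ)
    (hnotmult : ∀ m, 1 ≤ m → m ≤ M → ∀ l : ℕ, τ m ≠ (l : ℝ) * Δ) :
    ∑ i ∈ Finset.range (Nat.floor (t / Δ) - k + 1),
        |∑ j ∈ Finset.Icc 1 (k - 1), g ((j : ℝ) / k) *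
            (x (((i + j : ℕ) : ℝ) * Δ) - x (((i + j - 1 : ℕ) : ℝ) * Δ))| ^ p =
      (∑ j ∈ Finset.Icc 1 k, |g ((j : ℝ) / k)| ^ p) *
        ∑ m ∈ Finset.Icc 1 M, |a m| ^ p := by
  obtain ⟨-, -, -, hg1, -⟩ := hg
  obtain ⟨n, hn⟩ : ∃ n : ℕ → ℕ, ∀ m, n m = ⌈τ m / Δ⌉₊ := ⟨_, fun _ => rfl⟩
  have hle : ∀ m (l : ℕ), τ m ≤ (l : ℝ) * Δ ↔ n m ≤ l := by
    intro m l
    rw [hn, Nat.ceil_le, div_le_iff₀ hΔ]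
  have hlt : ∀ m, 1 ≤ m → m ≤ M → (n m : ℝ) < τ m / Δ + 1 := by
    intro m h1 h2
    rw [hn]
    exact Nat.ceil_lt_add_one (div_pos (hτpos m h1 h2) hΔ).le
  have hge : ∀ m, τ m / Δ ≤ n m := by
    intro m
    rw [hn]
    exact Nat.le_ceil _
  have hstep : ∀ m, 1 ≤ m → m < M → n m + k ≤ n (m + 1) := by
    intro m h1 h2
    have e1 := hlt m h1 h2.le
    have e2 := hge (m + 1)
    have e3 : (k : ℝ) < τ (m + 1) / Δ - τ m / Δ := by
      rw [← sub_div, lt_div_iff₀ hΔ]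
      exact hgap m h1 h2
    have e4 : ((n m + k : ℕ) : ℝ) < ((n (m + 1) + 1 : ℕ) : ℝ) := by
      push_cast
      linarith
    have e5 : n m + k < n (m + 1) + 1 := by exact_mod_cast e4
    omega
  have hsep : ∀ m d, 1 ≤ m → m + d + 1 ≤ M → n m + k ≤ n (m + d + 1) := by
    intro m d h1
    induction d with
    | zero => intro h2; exact hstep m h1 (by omega)
    | succ d ih =>
      intro h2
      have := ih (by omega)
      have := hstep (m + d + 1) (by omega) (by omega)
      have e : m + (d + 1) + 1 = m + d + 1 + 1 := by ring
      rw [e]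
      omega
  have hsep' : ∀ m m', 1 ≤ m → m < m' → m' ≤ M → n m + k ≤ n m' := by
    intro m m' h1 h2 h3
    obtain ⟨d, rfl⟩ := Nat.exists_eq_add_of_lt h2
    exact hsep m d h1 h3
  have hlow : ∀ m, 1 ≤ m → m ≤ M → k < n m := by
    intro m h1 h2
    have e1 : k < n 1 := by
      have e2 := hge 1
      have e3 : (k : ℝ) < τ 1 / Δ := by
        rw [lt_div_iff₀ hΔ]
        exact hfirst (by omega)
      exact_mod_cast e3.trans_le e2
    rcases Nat.eq_or_lt_of_le h1 with h | h
    · rw [← h]; exact e1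
    · have := hsep' 1 m le_rfl h h2
      omega
  have hup : ∀ m, 1 ≤ m → m ≤ M → n m + 2 * k ≤ Nat.floor (t / Δ) + 1 := by
    intro m h1 h2
    have e1 : n M + 2 * k ≤ Nat.floor (t / Δ) + 1 := by
      have e2 := hlt M (by omega) le_rfl
      have e3 : τ M / Δ ≤ t / Δ - 2 * k := by
        rw [div_le_iff₀ hΔ, sub_mul, div_mul_cancel₀ _ hΔ.ne']
        exact hlast (by omega)
      have e4 : n M + 2 * k - 1 ≤ Nat.floor (t / Δ) := by
        apply Nat.le_floor
        rw [Nat.cast_sub (by omega)]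
        push_cast
        linarith
      omega
    rcases Nat.eq_or_lt_of_le h2 with h | h
    · rw [h]; exact e1
    · have := hsep' m M h1 h le_rfl
      omega
  let H : ℕ → ℕ → ℝ := fun i m =>
    if i < n m ∧ n m < i + k then g (((n m - i : ℕ) : ℝ) / k) else 0
  have hinner : ∀ i : ℕ, ∑ j ∈ Finset.Icc 1 (k - 1), g ((j : ℝ) / k) *
            (x (((i + j : ℕ) : ℝ) * Δ) - x (((i + j - 1 : ℕ) : ℝ) * Δ))
      = ∑ m ∈ Finset.Icc 1 M, a m * H i m := by
    intro i
    simp only [hx, hle]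
    simp only [← Finset.sum_sub_distrib, Finset.mul_sum]
    rw [Finset.sum_comm]
    apply Finset.sum_congr rfl
    intro m hm
    have e1 : ∀ j ∈ Finset.Icc 1 (k - 1), g ((j : ℝ) / k) *
        ((if n m ≤ i + j then a m else 0) - (if n m ≤ i + j - 1 then a m else 0))
        = if n m = i + j then a m * g ((j : ℝ) / k) else 0 := by
      intro j hj
      rw [Finset.mem_Icc] at hj
      split_ifs <;> first | (exfalso; omega) | ring
    rw [Finset.sum_congr rfl e1]
    by_cases hc : i < n m ∧ n m < i + k
    · rw [Finset.sum_eq_single_of_mem (n m - i) (by rw [Finset.mem_Icc]; omega)]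
      · rw [if_pos (by omega)]
        simp only [H, if_pos hc]
      · intro b hb hbm
        rw [if_neg (by omega)]
    · simp only [H, if_neg hc, mul_zero]
      apply Finset.sum_eq_zero
      intro j hj
      rw [Finset.mem_Icc] at hj
      rw [if_neg (by omega)]
  have hpow : ∀ i : ℕ, |∑ m ∈ Finset.Icc 1 M, a m * H i m| ^ p
      = ∑ m ∈ Finset.Icc 1 M, |a m| ^ p * |H i m| ^ p := by
    intro i
    rw [abs_sum_rpow_aux _ _ p hp]
    · apply Finset.sum_congr rfl
      intro m hm
      rw [abs_mul, Real.mul_rpow (abs_nonneg _) (abs_nonneg _)]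
    · intro m hm m' hm' h1 h2
      rw [Finset.mem_Icc] at hm hm'
      have c1 : i < n m ∧ n m < i + k := by
        by_contra hc
        exact h1 (by simp only [H, if_neg hc, mul_zero])
      have c2 : i < n m' ∧ n m' < i + k := by
        by_contra hc
        exact h2 (by simp only [H, if_neg hc, mul_zero])
      rcases lt_trichotomy m m' with h | h | h
      · have := hsep' m m' hm.1 h hm'.2
        omega
      · exact h
      · have := hsep' m' m hm'.1 h hm.2
        omega
  simp only [hinner, hpow]
  rw [Finset.sum_comm, Finset.mul_sum]
  apply Finset.sum_congr rfl
  intro m hm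
  rw [Finset.mem_Icc] at hm
  rw [← Finset.mul_sum, mul_comm]
  congr 1
  have hl := hlow m hm.1 hm.2
  have hu := hup m hm.1 hm.2
  symm
  have hk1 : k = k - 1 + 1 := by omega
  have hkk : (k : ℝ) ≠ 0 := by
    have : k ≠ 0 := by omega
    exact_mod_cast this
  have hlastterm : ∑ j ∈ Finset.Icc 1 k, |g ((j : ℝ) / k)| ^ p
      = ∑ j ∈ Finset.Icc 1 (k - 1), |g ((j : ℝ) / k)| ^ p := by
    symm
    apply Finset.sum_subset
    · intro j hj
      rw [Finset.mem_Icc] at hj ⊢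
      omega
    · intro j hj hj'
      rw [Finset.mem_Icc] at hj hj'
      have : j = k := by omega
      rw [this, div_self hkk, hg1, abs_zero, Real.zero_rpow hp.ne']
  rw [hlastterm]
  apply Finset.sum_of_injOn (fun j => n m - j)
  · intro j hj j' hj' h
    simp only [Finset.coe_Icc, Set.mem_Icc] at hj hj' h
    omega
  · intro j hj
    simp only [Finset.coe_Icc, Set.mem_Icc, Finset.coe_range, Set.mem_Iio] at hj ⊢
    omega
  · intro i hi hni
    have hc : ¬ (i < n m ∧ n m < i + k) := by
      intro hc
      apply hni
      refine ⟨n m - i, ?_, ?_⟩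
      · simp only [Finset.coe_Icc, Set.mem_Icc]
        omega
      · simp only
        omega
    simp only [H, if_neg hc, abs_zero, Real.zero_rpow hp.ne']
  · intro j hj
    rw [Finset.mem_Icc] at hj
    have hc : n m - j < n m ∧ n m < n m - j + k := by omega
    have hj2 : n m - (n m - j) = j := by omega
    simp only [H, if_pos hc, hj2]
end

section
/- Let f: [0, ∞) × [0, ∞) → ℝ be measurable and bounded, and assume that f(s + u, t + u) = f(s, t) for all s, t, u ≥ 0 and that f(s, t) = 0 whenever |s − t| > 1. Then (1/T) ∫₀^T ∫₀^T f(s, t) ds dt → ∫₀² f(1, u) du as T → ∞. -/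
open Filter

theorem aux_II (f : ℝ → ℝ → ℝ)
    (hmeas : Measurable fun q : ℝ × ℝ => f q.1 q.2)
    (C : ℝ) (hbdd : ∀ s t : ℝ, 0 ≤ s → 0 ≤ t → |f s t| ≤ C) (s : ℝ) (hs : 0 ≤ s)
    (a b : ℝ) (ha : 0 ≤ a) (hb : 0 ≤ b) :
    IntervalIntegrable (fun t => f s t) MeasureTheory.volume a b := by
  have hm : Measurable fun t => f s t := hmeas.comp (measurable_const.prodMk measurable_id)
  refine (intervalIntegrable_const (c := C)).mono_fun hm.aestronglyMeasurable ?_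
  refine (MeasureTheory.ae_restrict_iff' measurableSet_uIoc).2 (Eventually.of_forall ?_)
  intro t ht
  have h0 : 0 ≤ t := (le_min ha hb).trans ht.1.le
  exact (hbdd s t hs h0).trans (le_abs_self C)

theorem aux_G (f : ℝ → ℝ → ℝ)
    (hmeas : Measurable fun q : ℝ × ℝ => f q.1 q.2)
    (C : ℝ) (hbdd : ∀ s t : ℝ, 0 ≤ s → 0 ≤ t → |f s t| ≤ C)
    (hsupp : ∀ s t : ℝ, 0 ≤ s → 0 ≤ t → 1 < |s - t| → f s t = 0)
    (T s : ℝ) (hs : 0 ≤ s) (hsT : s ≤ T) :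
    ∫ t in (0 : ℝ)..T, f s t = ∫ t in (max 0 (s-1))..(min T (s+1)), f s t := by
  have ha : 0 ≤ max 0 (s-1) := le_max_left _ _
  have hb : 0 ≤ min T (s+1) := le_min (by linarith) (by linarith)
  have hT : 0 ≤ T := by linarith
  have I := aux_II f hmeas C hbdd s hs
  rw [← intervalIntegral.integral_add_adjacent_intervals (I 0 _ le_rfl ha) (I _ T ha hT),
    ← intervalIntegral.integral_add_adjacent_intervals (I _ _ ha hb) (I _ T hb hT)]
  have h1 : ∫ t in (0 : ℝ)..(max 0 (s-1)), f s t = 0 := by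
    apply intervalIntegral.integral_zero_ae
    have : ∀ᵐ t : ℝ, t ≠ s - 1 := MeasureTheory.compl_mem_ae_iff.2 (MeasureTheory.measure_singleton _)
    filter_upwards [this] with t ht h
    rw [Set.uIoc_of_le ha] at h
    apply hsupp s t hs h.1.le
    have : t ≤ s - 1 := by
      rcases le_max_iff.1 h.2 with h' | h'
      · exact absurd h.1 (not_lt.2 h')
      · exact h'
    have := lt_of_le_of_ne this ht
    exact lt_of_lt_of_le (by linarith) (le_abs_self _)
  have h2 : ∫ t in (min T (s+1))..T, f s t = 0 := by
    apply intervalIntegral.integral_zero_ae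
    refine Eventually.of_forall fun t h => ?_
    rw [Set.uIoc_of_le (min_le_left _ _)] at h
    apply hsupp s t hs (hb.trans h.1.le)
    have : s + 1 < t := by
      rcases min_lt_iff.1 h.1 with h' | h'
      · exact absurd h.2 (not_le.2 h')
      · exact h'
    exact lt_of_lt_of_le (by linarith) (neg_le_abs _)
  rw [h1, h2]; ring

theorem stmt14 (f : ℝ → ℝ → ℝ)
    (hmeas : Measurable fun q : ℝ × ℝ => f q.1 q.2)
    (C : ℝ) (hbdd : ∀ s t : ℝ, 0 ≤ s → 0 ≤ t → |f s t| ≤ C)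
    (hshift : ∀ s t u : ℝ, 0 ≤ s → 0 ≤ t → 0 ≤ u → f (s + u) (t + u) = f s t)
    (hsupp : ∀ s t : ℝ, 0 ≤ s → 0 ≤ t → 1 < |s - t| → f s t = 0) :
    Tendsto (fun T : ℝ => (1 / T) * ∫ s in (0 : ℝ)..T, ∫ t in (0 : ℝ)..T, f s t)
      atTop (nhds (∫ u in (0 : ℝ)..2, f 1 u)) := by
  have hC : 0 ≤ C := (abs_nonneg _).trans (hbdd 0 0 le_rfl le_rfl)
  set J := ∫ u in (0 : ℝ)..2, f 1 u with hJ
  have hJb : |J| ≤ 2 * C := by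
    have := intervalIntegral.norm_integral_le_of_norm_le_const (a := 0) (b := 2)
      (f := fun u => f 1 u) (C := C) (fun u hu => by
        rw [Set.uIoc_of_le (by norm_num)] at hu
        exact hbdd 1 u zero_le_one hu.1.le)
    rw [Real.norm_eq_abs] at this
    norm_num at this
    linarith
  have hGb : ∀ T s : ℝ, 0 ≤ s → s ≤ T → |∫ t in (0 : ℝ)..T, f s t| ≤ 2 * C := by
    intro T s hs hsT
    rw [aux_G f hmeas C hbdd hsupp T s hs hsT]
    have hab : max 0 (s-1) ≤ min T (s+1) :=
      max_le (le_min (by linarith) (by linarith)) (le_min (by linarith) (by linarith))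
    have := intervalIntegral.norm_integral_le_of_norm_le_const
      (a := max 0 (s-1)) (b := min T (s+1))
      (f := fun u => f s u) (C := C) (fun u hu => by
        rw [Set.uIoc_of_le hab] at hu
        exact hbdd s u hs ((le_max_left _ _).trans hu.1.le))
    rw [Real.norm_eq_abs, abs_of_nonneg (sub_nonneg.2 hab)] at this
    have h1 := min_le_right T (s+1)
    have h2 := le_max_right 0 (s-1)
    nlinarith
  have hmid : ∀ T s : ℝ, 1 ≤ s → s ≤ T - 1 → ∫ t in (0 : ℝ)..T, f s t = J := by
    intro T s hs hsT
    rw [aux_G f hmeas C hbdd hsupp T s (by linarith) (by linarith),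
      max_eq_right (by linarith), min_eq_right (by linarith), hJ]
    have := intervalIntegral.integral_comp_add_right (a := 0) (b := 2) (fun t => f s t) (s - 1)
    rw [show (0:ℝ) + (s-1) = s - 1 by ring, show (2:ℝ) + (s-1) = s + 1 by ring] at this
    rw [← this]
    apply intervalIntegral.integral_congr
    intro u hu
    rw [Set.uIcc_of_le (by norm_num)] at hu
    have := hshift 1 u (s-1) zero_le_one hu.1 (by linarith)
    simpa using this
  have hkey : ∀ T : ℝ, 2 ≤ T →
      |(∫ s in (0 : ℝ)..T, ∫ t in (0 : ℝ)..T, f s t) - T * J| ≤ 8 * C := by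
    intro T hT
    set G : ℝ → ℝ := fun s => (∫ t in (0 : ℝ)..T, f s t) with hG
    have hGm : MeasureTheory.StronglyMeasurable G := by
      have : G = fun s => ∫ t in Set.Ioc 0 T, f s t := by
        ext s; exact intervalIntegral.integral_of_le (by linarith)
      rw [this]
      exact hmeas.stronglyMeasurable.integral_prod_right
    have hd : ∀ s, 0 ≤ s → s ≤ T → ‖G s - J‖ ≤ 4 * C := fun s h0 h1 => by
      have := hGb T s h0 h1
      exact (abs_sub _ _).trans (by simp only [hG]; linarith)
    have hI : ∀ a b, 0 ≤ a → a ≤ b → b ≤ T →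
        IntervalIntegrable (fun s => G s - J) MeasureTheory.volume a b := by
      intro a b ha hab hb
      refine (intervalIntegrable_const (c := 4 * C)).mono_fun
        (hGm.sub MeasureTheory.stronglyMeasurable_const).aestronglyMeasurable ?_
      refine (MeasureTheory.ae_restrict_iff' measurableSet_uIoc).2 (Eventually.of_forall ?_)
      intro t ht
      rw [Set.uIoc_of_le hab] at ht
      exact (hd t (ha.trans ht.1.le) (ht.2.trans hb)).trans (le_abs_self _)
    have e : (∫ s in (0 : ℝ)..T, G s) - T * J = ∫ s in (0 : ℝ)..T, (G s - J) := by
      have hi : IntervalIntegrable G MeasureTheory.volume 0 T := by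
        have := (hI 0 T le_rfl (by linarith) le_rfl).add (intervalIntegrable_const (c := J))
        refine this.congr ?_
        intro x _
        simp
      rw [intervalIntegral.integral_sub hi intervalIntegrable_const]
      simp
    rw [e, ← intervalIntegral.integral_add_adjacent_intervals
      (hI 0 1 le_rfl zero_le_one (by linarith)) (hI 1 T zero_le_one (by linarith) le_rfl),
      ← intervalIntegral.integral_add_adjacent_intervals
      (hI 1 (T-1) zero_le_one (by linarith) (by linarith))
      (hI (T-1) T (by linarith) (by linarith) le_rfl)]
    have z : ∫ s in (1:ℝ)..(T-1), (G s - J) = 0 := by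
      apply intervalIntegral.integral_zero_ae
      refine Eventually.of_forall fun s h => ?_
      rw [Set.uIoc_of_le (by linarith)] at h
      exact sub_eq_zero.2 (hmid T s h.1.le h.2)
    have b1 := intervalIntegral.norm_integral_le_of_norm_le_const (a := 0) (b := 1)
      (f := fun s => G s - J) (C := 4 * C) (fun u hu => by
        rw [Set.uIoc_of_le (by norm_num)] at hu
        exact hd u hu.1.le (by linarith [hu.2]))
    have b2 := intervalIntegral.norm_integral_le_of_norm_le_const (a := T-1) (b := T)
      (f := fun s => G s - J) (C := 4 * C) (fun u hu => by
        rw [Set.uIoc_of_le (by linarith)] at hu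
        exact hd u (by linarith [hu.1]) hu.2)
    rw [Real.norm_eq_abs] at b1 b2
    norm_num at b1 b2
    rw [z, zero_add]
    exact (abs_add_le _ _).trans (by linarith)
  rw [tendsto_iff_norm_sub_tendsto_zero]
  have hlim : Tendsto (fun T : ℝ => (8 * C) / T) atTop (nhds 0) :=
    tendsto_const_nhds.div_atTop tendsto_id
  refine squeeze_zero' (Eventually.of_forall fun _ => norm_nonneg _) ?_ hlim
  filter_upwards [eventually_ge_atTop (2:ℝ)] with T hT
  have hT0 : 0 < T := by linarith
  have : (1 / T) * (∫ s in (0 : ℝ)..T, ∫ t in (0 : ℝ)..T, f s t) - J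
      = ((∫ s in (0 : ℝ)..T, ∫ t in (0 : ℝ)..T, f s t) - T * J) / T := by
    field_simp
  rw [this, Real.norm_eq_abs, abs_div, abs_of_pos hT0]
  exact div_le_div_of_nonneg_right (hkey T hT) hT0.le
end

section
/- Let g and h be weight functions and let t, t' ≥ 0. Then, as k → ∞, k · Σ_{j ∈ ℤ} ( g(j/k) − g((j−1)/k) ) · ( h( (j + ⌊kt⌋ − ⌊kt'⌋)/k ) − h( (j − 1 + ⌊kt⌋ − ⌊kt'⌋)/k ) ) → ∫_ℝ g'(v − t) h'(v − t') dv. -/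
open Filter

open MeasureTheory in
theorem aux_floor_integral (φ : ℤ → ℝ) (hφ : Integrable (fun w : ℝ => φ ⌊w⌋)) :
    ∫ w : ℝ, φ ⌊w⌋ = ∑' n : ℤ, φ n := by
  rw [← setIntegral_univ, ← iUnion_Ico_intCast ℝ,
    integral_iUnion (fun n => measurableSet_Ico) (Set.pairwise_disjoint_Ico_intCast ℝ)
      hφ.integrableOn]
  congr 1
  ext n
  rw [setIntegral_congr_fun (g := fun _ => φ n) measurableSet_Ico]
  · simp
  · intro w hw
    have : ⌊w⌋ = n := Int.floor_eq_iff.2 hw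
    simp [this]

theorem aux_cover (t : ℕ → ℝ) (x : ℝ) (n : ℕ) (h0 : t 0 ≤ x) (hn : x ≤ t n)
    (hx : ∀ i ≤ n, x ≠ t i) : ∃ i < n, x ∈ Set.Ioo (t i) (t (i + 1)) := by
  induction n with
  | zero => exact absurd (le_antisymm hn h0) (hx 0 le_rfl)
  | succ n ih =>
    rcases le_or_gt x (t n) with h | h
    · obtain ⟨i, hi, hi'⟩ := ih h (fun i hi => hx i (by omega))
      exact ⟨i, by omega, hi'⟩
    · exact ⟨n, by omega, h, lt_of_le_of_ne hn (hx _ le_rfl)⟩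

theorem aux_strict {g gd : ℝ → ℝ} {U : Set ℝ} (hU : IsOpen U)
    (hd : ∀ x ∈ U, HasDerivAt g (gd x) x) (hc : ContinuousOn gd U) {x : ℝ} (hx : x ∈ U) :
    HasStrictDerivAt g (gd x) x := by
  refine hasStrictDerivAt_of_hasDerivAt_of_continuousAt ?_ (hc.continuousAt (hU.mem_nhds hx))
  filter_upwards [hU.mem_nhds hx] with y hy using hd y hy

theorem aux_bound {g gd : ℝ → ℝ} (hg : IsWeight g gd) :
    ∃ (S : Set ℝ) (M : ℝ), S.Finite ∧ 0 ≤ M ∧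
      ∀ x ∉ S, HasStrictDerivAt g (gd x) x ∧ |gd x| ≤ M := by
  obtain ⟨hcont, hz, -, -, hz', r, t, L, hr, ht0, htr, hmono, hp⟩ := hg
  have hB : ∀ i < r, ∃ B, ∀ x ∈ Set.Ioo (t i) (t (i+1)), |gd x| ≤ B := by
    intro i hi
    set c := (t i + t (i+1)) / 2 with hc
    have hm := hmono i hi
    have hcm : c ∈ Set.Ioo (t i) (t (i+1)) := ⟨by linarith, by linarith⟩
    refine ⟨|gd c| + L * (t (i+1) - t i), fun x hx => ?_⟩
    have h1 := (hp i hi).2.dist_le_mul x hx c hcm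
    rw [Real.dist_eq, Real.dist_eq] at h1
    have h2 : |x - c| ≤ t (i+1) - t i := by
      rw [abs_le]; constructor <;> linarith [hx.1, hx.2, hcm.1, hcm.2]
    have h3 : (L:ℝ) * |x - c| ≤ L * (t (i+1) - t i) := mul_le_mul_of_nonneg_left h2 L.2
    have h4 := abs_sub_abs_le_abs_sub (gd x) (gd c)
    linarith
  choose! B hB using hB
  refine ⟨t '' (Finset.range (r+1) : Set ℕ), ∑ i ∈ Finset.range r, |B i|,
    (Finset.finite_toSet _).image _, Finset.sum_nonneg (fun _ _ => abs_nonneg _), ?_⟩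
  intro x hx
  have hx' : ∀ i ≤ r, x ≠ t i := fun i hi h =>
    hx ⟨i, by simp; omega, h.symm⟩
  by_cases hxI : x ∈ Set.Icc (0:ℝ) 1
  · obtain ⟨i, hi, hxi⟩ := aux_cover t x r (ht0 ▸ hxI.1) (htr ▸ hxI.2) hx'
    refine ⟨aux_strict isOpen_Ioo (hp i hi).1 (hp i hi).2.continuousOn hxi, ?_⟩
    refine (hB i hi x hxi).trans ((le_abs_self _).trans ?_)
    exact Finset.single_le_sum (f := fun i => |B i|) (fun _ _ => abs_nonneg _)
      (Finset.mem_range.2 hi)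
  · constructor
    · refine aux_strict (U := (Set.Icc (0:ℝ) 1)ᶜ) isClosed_Icc.isOpen_compl ?_ ?_ hxI
      · intro y hy
        rw [hz' y hy]
        refine (hasDerivAt_const y (0:ℝ)).congr_of_eventuallyEq ?_
        filter_upwards [isClosed_Icc.isOpen_compl.mem_nhds hy] with z hzz using hz z hzz
      · exact (continuousOn_const (c := (0:ℝ))).congr (fun y hy => hz' y hy)
    · rw [hz' x hxI, abs_zero]
      exact Finset.sum_nonneg (fun _ _ => abs_nonneg _)

open MeasureTheory in
theorem aux_lip_s15 {g gd : ℝ → ℝ} (hc : Continuous g) {S : Set ℝ} {M : ℝ} (hS : S.Finite)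
    (hM : ∀ x ∉ S, HasStrictDerivAt g (gd x) x ∧ |gd x| ≤ M) (a b : ℝ) :
    |g b - g a| ≤ M * |b - a| := by
  have hae : ∀ᵐ x : ℝ, x ∉ S := by
    rw [ae_iff]; simpa using hS.measure_zero volume
  have hmeas : AEStronglyMeasurable gd volume := by
    refine (measurable_deriv g).aestronglyMeasurable.congr ?_
    filter_upwards [hae] with x hx using (hM x hx).1.hasDerivAt.deriv
  have hint : IntervalIntegrable gd volume a b := by
    refine (intervalIntegrable_const (c := M)).mono_fun hmeas.restrict ?_
    refine ae_restrict_of_ae ?_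
    filter_upwards [hae] with x hx
    rw [Real.norm_eq_abs, Real.norm_eq_abs]
    exact (hM x hx).2.trans (le_abs_self _)
  rw [← integral_eq_of_hasDerivAt_off_countable g gd hS.countable hc.continuousOn
    (fun x hx => (hM x hx.2).1.hasDerivAt) hint]
  rw [← Real.norm_eq_abs]
  refine intervalIntegral.norm_integral_le_of_norm_le_const_ae ?_
  filter_upwards [hae] with x hx _ using (hM x hx).2

theorem aux_tendsto {g : ℝ → ℝ} {d x : ℝ} (hd : HasStrictDerivAt g d x) (a b : ℕ → ℝ)
    (ha : Tendsto a atTop (nhds x)) (hab : ∀ k : ℕ, 0 < k → b k = a k + 1 / k) :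
    Tendsto (fun k : ℕ => (k : ℝ) * (g (b k) - g (a k))) atTop (nhds d) := by
  have hb : Tendsto b atTop (nhds x) := by
    have := ha.add (tendsto_one_div_atTop_nhds_zero_nat (𝕜 := ℝ))
    rw [add_zero] at this
    refine this.congr' ?_
    filter_upwards [eventually_gt_atTop 0] with k hk using (hab k hk).symm
  have h1 := (hasStrictDerivAt_iff_hasStrictFDerivAt.1 hd).isLittleO.comp_tendsto (hb.prodMk_nhds ha)
  have h2 := h1.tendsto_div_nhds_zero
  have h3 := h2.add_const d
  rw [zero_add] at h3
  refine h3.congr' ?_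
  filter_upwards [eventually_gt_atTop 0] with k hk
  have hk' : (k:ℝ) ≠ 0 := by positivity
  have : b k - a k = 1 / k := by rw [hab k hk]; ring
  simp only [Function.comp, this, ContinuousLinearMap.toSpanSingleton_apply, smul_eq_mul]
  field_simp
  ring

theorem aux_floor_tendsto (u : ℝ) :
    Tendsto (fun k : ℕ => (⌊(k:ℝ) * u⌋ : ℝ) / k) atTop (nhds u) := by
  have h1 : Tendsto (fun k : ℕ => u - 1 / (k:ℝ)) atTop (nhds u) := by
    simpa using tendsto_const_nhds.sub (tendsto_one_div_atTop_nhds_zero_nat (𝕜 := ℝ))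
  refine tendsto_of_tendsto_of_tendsto_of_le_of_le' h1 tendsto_const_nhds ?_ ?_
  · filter_upwards [eventually_gt_atTop 0] with k hk
    have hk' : (0:ℝ) < k := by positivity
    rw [le_div_iff₀ hk', sub_mul, one_div, inv_mul_cancel₀ hk'.ne']
    linarith [Int.sub_one_lt_floor ((k:ℝ) * u)]
  · filter_upwards [eventually_gt_atTop 0] with k hk
    have hk' : (0:ℝ) < k := by positivity
    rw [div_le_iff₀ hk']
    linarith [Int.floor_le ((k:ℝ) * u)]

open MeasureTheory in
/-- the Riemann-approximation limit (KL6678) in Step 1 of the proof of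
Lemma 5.2 of Jacod–Podolskij–Vetter. For weight functions `g, h` and `t, t' ≥ 0`,
`k · ∑_{j ∈ ℤ} (g(j/k) - g((j-1)/k)) (h((j+⌊kt⌋-⌊kt'⌋)/k) - h((j-1+⌊kt⌋-⌊kt'⌋)/k))`
converges to `∫ g'(v-t) h'(v-t') dv` as `k → ∞`. -/
theorem stmt15 (g gd h hd : ℝ → ℝ) (hg : IsWeight g gd) (hh : IsWeight h hd)
    (t t' : ℝ) (ht : 0 ≤ t) (ht' : 0 ≤ t') :
    Tendsto (fun k : ℕ =>
      (k : ℝ) * ∑' j : ℤ,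
        (g ((j : ℝ) / k) - g (((j : ℝ) - 1) / k)) *
          (h (((j + ⌊(k : ℝ) * t⌋ - ⌊(k : ℝ) * t'⌋ : ℤ) : ℝ) / k) -
            h ((((j + ⌊(k : ℝ) * t⌋ - ⌊(k : ℝ) * t'⌋ : ℤ) : ℝ) - 1) / k)))
      atTop (nhds (∫ v : ℝ, gd (v - t) * hd (v - t'))) := by
  obtain ⟨S, M, hS, hM0, hM⟩ := aux_bound hg
  obtain ⟨S', M', hS', hM0', hM'⟩ := aux_bound hh
  have hL := aux_lip_s15 hg.1 hS hM
  have hL' := aux_lip_s15 hh.1 hS' hM'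
  set m : ℕ → ℤ := fun k => ⌊(k : ℝ) * t⌋ - ⌊(k : ℝ) * t'⌋ with hm
  set φ : ℕ → ℤ → ℝ := fun k n =>
    ((k:ℝ) * (g (((n:ℝ) + 1) / k) - g ((n:ℝ) / k))) *
      ((k:ℝ) * (h (((n:ℝ) + m k + 1) / k) - h (((n:ℝ) + m k) / k))) with hφ
  have hbnd : ∀ k : ℕ, 0 < k → ∀ u : ℝ,
      ‖φ k ⌊(k:ℝ) * u⌋‖ ≤ (Set.Icc (-1:ℝ) 2).indicator (fun _ => M * M') u := by
    intro k hk u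
    have hk' : (0:ℝ) < k := by positivity
    have hk1 : (1:ℝ) ≤ k := by exact_mod_cast hk
    have key : ∀ (f : ℝ → ℝ) (C : ℝ), (∀ a b, |f b - f a| ≤ C * |b - a|) → ∀ y : ℝ,
        |(k:ℝ) * (f ((y + 1) / k) - f (y / k))| ≤ C := by
      intro f C hf y
      have := hf (y / k) ((y + 1) / k)
      rw [show (y + 1) / (k:ℝ) - y / k = 1 / k by ring,
        abs_of_pos (show (0:ℝ) < 1 / k by positivity)] at this
      rw [abs_mul, abs_of_pos hk']
      calc (k:ℝ) * _ ≤ k * (C * (1 / k)) := mul_le_mul_of_nonneg_left this hk'.le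
        _ = C := by field_simp
    by_cases hu : u ∈ Set.Icc (-1:ℝ) 2
    · rw [Set.indicator_of_mem hu, Real.norm_eq_abs, abs_mul]
      exact mul_le_mul (key g M hL _) (key h M' hL' _) (abs_nonneg _) hM0
    · rw [Set.indicator_of_notMem hu]
      have f1 := Int.floor_le ((k:ℝ) * u)
      have f2 := Int.lt_floor_add_one ((k:ℝ) * u)
      have e : ∀ y : ℝ, y = ⌊(k:ℝ) * u⌋ ∨ y = ⌊(k:ℝ) * u⌋ + 1 → g (y / k) = 0 := by
        intro y hy
        apply hg.2.1
        rintro ⟨y1, y2⟩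
        rw [le_div_iff₀ hk'] at y1
        rw [div_le_iff₀ hk'] at y2
        apply hu
        constructor
        · by_contra! hc
          have : (k:ℝ) * u < k * (-1) := mul_lt_mul_of_pos_left hc hk'
          rcases hy with hy | hy
          · linarith
          · have hlt : (⌊(k:ℝ) * u⌋ : ℝ) + 1 < 1 := by linarith
            have h5 : (0:ℝ) ≤ (⌊(k:ℝ) * u⌋ : ℝ) + 1 := by linarith
            linarith
        · by_contra! hc
          have : (k:ℝ) * 2 < k * u := mul_lt_mul_of_pos_left hc hk'
          rcases hy with hy | hy <;> linarith
      simp [hφ, e _ (Or.inl rfl), e _ (Or.inr rfl)]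
  have hmeas : ∀ k : ℕ, AEStronglyMeasurable (fun u : ℝ => φ k ⌊(k:ℝ) * u⌋) volume := by
    intro k
    exact ((measurable_of_countable (φ k)).comp
      (Int.measurable_floor.comp (measurable_const_mul (k:ℝ)))).aestronglyMeasurable
  have hbint : Integrable ((Set.Icc (-1:ℝ) 2).indicator (fun _ => M * M')) volume :=
    (integrable_indicator_iff measurableSet_Icc).2 (integrableOn_const (by simp))
  have hae : ∀ᵐ x : ℝ, x ∉ S := by
    rw [ae_iff]; simpa using hS.measure_zero volume
  have hae' : ∀ᵐ x : ℝ, x + (t - t') ∉ S' := by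
    have hfin : ((fun x : ℝ => x + (t - t')) ⁻¹' S').Finite :=
      hS'.preimage (add_left_injective _).injOn
    have h0 := hfin.measure_zero volume
    rw [ae_iff]; simp only [not_not]; exact h0
  have hlim : Tendsto (fun k : ℕ => ∫ u : ℝ, φ k ⌊(k:ℝ) * u⌋) atTop
      (nhds (∫ u : ℝ, gd u * hd (u + (t - t')))) := by
    refine tendsto_integral_filter_of_dominated_convergence _
      (Eventually.of_forall hmeas) ?_ hbint ?_
    · filter_upwards [eventually_gt_atTop 0] with k hk
      exact Eventually.of_forall (hbnd k hk)
    · filter_upwards [hae, hae'] with u hu hu'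
      refine (aux_tendsto (hM u hu).1 _ _ (aux_floor_tendsto u) ?_).mul
        (aux_tendsto (hM' _ hu').1 _ _ ?_ ?_)
      · intro k hk; ring
      · have := (aux_floor_tendsto u).add ((aux_floor_tendsto t).sub (aux_floor_tendsto t'))
        refine this.congr fun k => ?_
        simp only [hm]; push_cast; ring
      · intro k hk; ring
  have hfin : ∫ v : ℝ, gd (v - t) * hd (v - t') = ∫ u : ℝ, gd u * hd (u + (t - t')) := by
    rw [← integral_sub_right_eq_self (fun u : ℝ => gd u * hd (u + (t - t'))) t]
    congr 1; ext v; congr 2; ring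
  rw [hfin]
  refine hlim.congr' ?_
  filter_upwards [eventually_gt_atTop 0] with k hk
  have hk' : (0:ℝ) < k := by positivity
  have hint : Integrable (fun u : ℝ => φ k ⌊(k:ℝ) * u⌋) volume :=
    hbint.mono' (hmeas k) (Eventually.of_forall (hbnd k hk))
  have hint' : Integrable (fun w : ℝ => φ k ⌊w⌋) volume :=
    (integrable_comp_mul_left_iff (fun w : ℝ => φ k ⌊w⌋) hk'.ne').1 hint
  rw [Measure.integral_comp_mul_left (fun w : ℝ => φ k ⌊w⌋) (k:ℝ),
    aux_floor_integral _ hint', ← (Equiv.subRight (1:ℤ)).tsum_eq (φ k), smul_eq_mul,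
    abs_of_pos (by positivity), ← tsum_mul_left, ← tsum_mul_left]
  congr 1
  ext j
  simp only [hφ, hm, Equiv.subRight_apply]
  push_cast
  rw [show (j:ℝ) - 1 + 1 = j by ring,
    show (j:ℝ) - 1 + (⌊(k:ℝ) * t⌋ - ⌊(k:ℝ) * t'⌋) + 1 = j + ⌊(k:ℝ) * t⌋ - ⌊(k:ℝ) * t'⌋ by ring,
    show (j:ℝ) - 1 + (⌊(k:ℝ) * t⌋ - ⌊(k:ℝ) * t'⌋) = j + ⌊(k:ℝ) * t⌋ - ⌊(k:ℝ) * t'⌋ - 1 by ring]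
  field_simp
end

section
/- Let g(x) = min(x, 1−x) for x ∈ [0,1] and g(x) = 0 otherwise, and let g' be its derivative: g'(x) = 1 for x ∈ (0, 1/2), g'(x) = −1 for x ∈ (1/2, 1), and 0 outside [0,1]. Then: (i) ∫₀¹ ( ∫_t¹ g(s) g(s−t) ds )² dt = 151/80640; (ii) ∫₀¹ ( ∫₀^{1−t} g(s) g(s+t) ds )² dt = 151/80640; (iii) ∫₀¹ ( ∫_t¹ g(s) g'(s−t) ds )² dt = 1/96; (iv) ∫₀¹ ( ∫₀^{1−t} g(s) g'(s+t) ds )² dt = 1/96; and (v) for all real η, ζ: 4 ∫₀¹ ( η² ∫_s¹ g(u) g(u−s) du + ζ² ∫_s¹ g'(u) g'(u−s) du )² ds = 4 ( (151/80640) η⁴ + (1/48) η² ζ² + (1/6) ζ⁴ ). -/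
/-- The triangular weight function `g(x) = min(x, 1-x)` on `[0,1]`, `0` elsewhere. -/
noncomputable def gTri : ℝ → ℝ := fun x =>
  if x ∈ Set.Icc (0 : ℝ) 1 then min x (1 - x) else 0

/-- The derivative of the triangular weight function: `1` on `(0, 1/2)`, `-1` on `(1/2, 1)`,
`0` elsewhere. -/
noncomputable def gTri' : ℝ → ℝ := fun x =>
  if x ∈ Set.Ioo (0 : ℝ) (1 / 2) then 1
  else if x ∈ Set.Ioo (1 / 2 : ℝ) 1 then -1 else 0

open MeasureTheory intervalIntegral Set

/-- An integrand agreeing with a continuous function on the open interval. -/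
lemma piece1 {f p : ℝ → ℝ} {a b : ℝ} (hab : a ≤ b) (hp : Continuous p)
    (h : ∀ x, a < x → x < b → f x = p x) :
    IntervalIntegrable f volume a b ∧ (∫ x in a..b, f x) = ∫ x in a..b, p x := by
  have h' : Set.EqOn p f (Set.Ioo a b) := fun x hx => (h x hx.1 hx.2).symm
  constructor
  · refine (hp.intervalIntegrable a b).congr_ae ?_
    rw [Set.uIoc_of_le hab, ← restrict_Ioo_eq_restrict_Ioc]
    exact (ae_restrict_mem measurableSet_Ioo).mono (fun x hx => h' hx)
  · rw [intervalIntegral.integral_of_le hab, intervalIntegral.integral_of_le hab,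
      integral_Ioc_eq_integral_Ioo, integral_Ioc_eq_integral_Ioo]
    exact (setIntegral_congr_fun measurableSet_Ioo h').symm

lemma piece2 {f p q : ℝ → ℝ} {a b c : ℝ} (hab : a ≤ b) (hbc : b ≤ c)
    (hp : Continuous p) (hq : Continuous q)
    (h1 : ∀ x, a < x → x < b → f x = p x) (h2 : ∀ x, b < x → x < c → f x = q x) :
    IntervalIntegrable f volume a c ∧
      (∫ x in a..c, f x) = (∫ x in a..b, p x) + ∫ x in b..c, q x := by
  obtain ⟨i1, e1⟩ := piece1 hab hp h1
  obtain ⟨i2, e2⟩ := piece1 hbc hq h2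
  exact ⟨i1.trans i2, by rw [← e1, ← e2, integral_add_adjacent_intervals i1 i2]⟩

lemma piece3 {f p q r : ℝ → ℝ} {a b c d : ℝ} (hab : a ≤ b) (hbc : b ≤ c) (hcd : c ≤ d)
    (hp : Continuous p) (hq : Continuous q) (hr : Continuous r)
    (h1 : ∀ x, a < x → x < b → f x = p x) (h2 : ∀ x, b < x → x < c → f x = q x)
    (h3 : ∀ x, c < x → x < d → f x = r x) :
    (∫ x in a..d, f x) = (∫ x in a..b, p x) + (∫ x in b..c, q x) + ∫ x in c..d, r x := by
  obtain ⟨i1, e1⟩ := piece2 hab hbc hp hq h1 h2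
  obtain ⟨i2, e2⟩ := piece1 hcd hr h3
  rw [← e1, ← e2, integral_add_adjacent_intervals i1 i2]

/-- Polynomials of degree at most six. -/
def pol (c0 c1 c2 c3 c4 c5 c6 : ℝ) : ℝ → ℝ := fun x =>
  c0 + c1 * x + c2 * x ^ 2 + c3 * x ^ 3 + c4 * x ^ 4 + c5 * x ^ 5 + c6 * x ^ 6

lemma pol_cont (c0 c1 c2 c3 c4 c5 c6 : ℝ) : Continuous (pol c0 c1 c2 c3 c4 c5 c6) := by
  unfold pol; fun_prop

/-- Antiderivative. -/
noncomputable def polI (c0 c1 c2 c3 c4 c5 c6 : ℝ) : ℝ → ℝ := fun x =>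
  c0 * x + c1 / 2 * x ^ 2 + c2 / 3 * x ^ 3 + c3 / 4 * x ^ 4 + c4 / 5 * x ^ 5 + c5 / 6 * x ^ 6
    + c6 / 7 * x ^ 7

lemma pol_int (c0 c1 c2 c3 c4 c5 c6 a b : ℝ) :
    (∫ x in a..b, pol c0 c1 c2 c3 c4 c5 c6 x) =
      polI c0 c1 c2 c3 c4 c5 c6 b - polI c0 c1 c2 c3 c4 c5 c6 a := by
  apply integral_eq_sub_of_hasDerivAt
  · intro x _
    have h (n : ℕ) (c : ℝ) := (hasDerivAt_pow n x).const_mul c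
    have H := ((((((h 1 c0).add (h 2 (c1/2))).add (h 3 (c2/3))).add (h 4 (c3/4))).add
      (h 5 (c4/5))).add (h 6 (c5/6))).add (h 7 (c6/7))
    convert H using 1
    · funext y; simp [polI]
    · simp [pol]; ring
  · exact (pol_cont _ _ _ _ _ _ _).intervalIntegrable _ _

lemma g_left {x : ℝ} (h0 : 0 < x) (h1 : x < 1 / 2) : gTri x = x := by
  rw [gTri, if_pos ⟨h0.le, by linarith⟩, min_eq_left (by linarith)]

lemma g_right {x : ℝ} (h0 : 1 / 2 < x) (h1 : x < 1) : gTri x = 1 - x := by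
  rw [gTri, if_pos ⟨by linarith, h1.le⟩, min_eq_right (by linarith)]

lemma g'_left {x : ℝ} (h0 : 0 < x) (h1 : x < 1 / 2) : gTri' x = 1 := by
  rw [gTri', if_pos ⟨h0, h1⟩]

lemma g'_right {x : ℝ} (h0 : 1 / 2 < x) (h1 : x < 1) : gTri' x = -1 := by
  rw [gTri', if_neg (fun h => by linarith [h.2]), if_pos ⟨h0, h1⟩]

lemma A_small {t : ℝ} (h0 : 0 < t) (h1 : t < 1 / 2) :
    (∫ s in t..1, gTri s * gTri (s - t)) = 1 / 12 - t ^ 2 / 2 + t ^ 3 / 2 := by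
  rw [piece3 (b := 1 / 2) (c := t + 1 / 2) (p := pol (0) (-t) (1) (0) (0) (0) (0))
    (q := pol (-t) (1 + t) (-1) (0) (0) (0) (0))
    (r := pol (1 + t) (-2 - t) (1) (0) (0) (0) (0)) (by linarith) (by linarith) (by linarith)
    (pol_cont _ _ _ _ _ _ _) (pol_cont _ _ _ _ _ _ _) (pol_cont _ _ _ _ _ _ _)
    ?_ ?_ ?_, pol_int, pol_int, pol_int]
  · simp only [polI]; ring
  · intro s hs1 hs2
    rw [g_left (x := s) (by linarith) (by linarith), g_left (x := s - t) (by linarith) (by linarith)]; simp only [pol]; ring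
  · intro s hs1 hs2
    rw [g_right (x := s) (by linarith) (by linarith), g_left (x := s - t) (by linarith) (by linarith)]; simp only [pol]; ring
  · intro s hs1 hs2
    rw [g_right (x := s) (by linarith) (by linarith), g_right (x := s - t) (by linarith) (by linarith)]; simp only [pol]; ring

lemma A_large {t : ℝ} (h0 : 1 / 2 < t) (h1 : t < 1) :
    (∫ s in t..1, gTri s * gTri (s - t)) = (1 - t) ^ 3 / 6 := by
  rw [(piece1 (p := pol (-t) (1 + t) (-1) (0) (0) (0) (0)) (by linarith)
    (pol_cont _ _ _ _ _ _ _) ?_).2, pol_int]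
  · simp only [polI]; ring
  · intro s hs1 hs2
    rw [g_right (x := s) (by linarith) (by linarith), g_left (x := s - t) (by linarith) (by linarith)]; simp only [pol]; ring

lemma A2_small {t : ℝ} (h0 : 0 < t) (h1 : t < 1 / 2) :
    (∫ s in (0 : ℝ)..(1 - t), gTri s * gTri (s + t)) = 1 / 12 - t ^ 2 / 2 + t ^ 3 / 2 := by
  rw [piece3 (b := 1 / 2 - t) (c := 1 / 2) (p := pol (0) (t) (1) (0) (0) (0) (0))
    (q := pol (0) (1 - t) (-1) (0) (0) (0) (0))
    (r := pol (1 - t) (t - 2) (1) (0) (0) (0) (0)) (by linarith) (by linarith) (by linarith)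
    (pol_cont _ _ _ _ _ _ _) (pol_cont _ _ _ _ _ _ _) (pol_cont _ _ _ _ _ _ _)
    ?_ ?_ ?_, pol_int, pol_int, pol_int]
  · simp only [polI]; ring
  · intro s hs1 hs2
    rw [g_left (x := s) (by linarith) (by linarith), g_left (x := s + t) (by linarith) (by linarith)]; simp only [pol]; ring
  · intro s hs1 hs2
    rw [g_left (x := s) (by linarith) (by linarith), g_right (x := s + t) (by linarith) (by linarith)]; simp only [pol]; ring
  · intro s hs1 hs2
    rw [g_right (x := s) (by linarith) (by linarith), g_right (x := s + t) (by linarith) (by linarith)]; simp only [pol]; ring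

lemma A2_large {t : ℝ} (h0 : 1 / 2 < t) (h1 : t < 1) :
    (∫ s in (0 : ℝ)..(1 - t), gTri s * gTri (s + t)) = (1 - t) ^ 3 / 6 := by
  rw [(piece1 (p := pol (0) (1 - t) (-1) (0) (0) (0) (0)) (by linarith)
    (pol_cont _ _ _ _ _ _ _) ?_).2, pol_int]
  · simp only [polI]; ring
  · intro s hs1 hs2
    rw [g_left (x := s) (by linarith) (by linarith), g_right (x := s + t) (by linarith) (by linarith)]; simp only [pol]; ring

lemma D_small {t : ℝ} (h0 : 0 < t) (h1 : t < 1 / 2) :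
    (∫ s in t..1, gTri s * gTri' (s - t)) = t - 3 / 2 * t ^ 2 := by
  rw [piece3 (b := 1 / 2) (c := t + 1 / 2) (p := pol (0) (1) (0) (0) (0) (0) (0))
    (q := pol (1) (-1) (0) (0) (0) (0) (0))
    (r := pol (-1) (1) (0) (0) (0) (0) (0)) (by linarith) (by linarith) (by linarith)
    (pol_cont _ _ _ _ _ _ _) (pol_cont _ _ _ _ _ _ _) (pol_cont _ _ _ _ _ _ _)
    ?_ ?_ ?_, pol_int, pol_int, pol_int]
  · simp only [polI]; ring
  · intro s hs1 hs2
    rw [g_left (x := s) (by linarith) (by linarith), g'_left (x := s - t) (by linarith) (by linarith)]; simp only [pol]; ring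
  · intro s hs1 hs2
    rw [g_right (x := s) (by linarith) (by linarith), g'_left (x := s - t) (by linarith) (by linarith)]; simp only [pol]; ring
  · intro s hs1 hs2
    rw [g_right (x := s) (by linarith) (by linarith), g'_right (x := s - t) (by linarith) (by linarith)]; simp only [pol]; ring

lemma D_large {t : ℝ} (h0 : 1 / 2 < t) (h1 : t < 1) :
    (∫ s in t..1, gTri s * gTri' (s - t)) = (1 - t) ^ 2 / 2 := by
  rw [(piece1 (p := pol (1) (-1) (0) (0) (0) (0) (0)) (by linarith)
    (pol_cont _ _ _ _ _ _ _) ?_).2, pol_int]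
  · simp only [polI]; ring
  · intro s hs1 hs2
    rw [g_right (x := s) (by linarith) (by linarith), g'_left (x := s - t) (by linarith) (by linarith)]; simp only [pol]; ring

lemma C_small {t : ℝ} (h0 : 0 < t) (h1 : t < 1 / 2) :
    (∫ s in (0 : ℝ)..(1 - t), gTri s * gTri' (s + t)) = -(t - 3 / 2 * t ^ 2) := by
  rw [piece3 (b := 1 / 2 - t) (c := 1 / 2) (p := pol (0) (1) (0) (0) (0) (0) (0))
    (q := pol (0) (-1) (0) (0) (0) (0) (0))
    (r := pol (-1) (1) (0) (0) (0) (0) (0)) (by linarith) (by linarith) (by linarith)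
    (pol_cont _ _ _ _ _ _ _) (pol_cont _ _ _ _ _ _ _) (pol_cont _ _ _ _ _ _ _)
    ?_ ?_ ?_, pol_int, pol_int, pol_int]
  · simp only [polI]; ring
  · intro s hs1 hs2
    rw [g_left (x := s) (by linarith) (by linarith), g'_left (x := s + t) (by linarith) (by linarith)]; simp only [pol]; ring
  · intro s hs1 hs2
    rw [g_left (x := s) (by linarith) (by linarith), g'_right (x := s + t) (by linarith) (by linarith)]; simp only [pol]; ring
  · intro s hs1 hs2
    rw [g_right (x := s) (by linarith) (by linarith), g'_right (x := s + t) (by linarith) (by linarith)]; simp only [pol]; ring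

lemma C_large {t : ℝ} (h0 : 1 / 2 < t) (h1 : t < 1) :
    (∫ s in (0 : ℝ)..(1 - t), gTri s * gTri' (s + t)) = -((1 - t) ^ 2 / 2) := by
  rw [(piece1 (p := pol (0) (-1) (0) (0) (0) (0) (0)) (by linarith)
    (pol_cont _ _ _ _ _ _ _) ?_).2, pol_int]
  · simp only [polI]; ring
  · intro s hs1 hs2
    rw [g_left (x := s) (by linarith) (by linarith), g'_right (x := s + t) (by linarith) (by linarith)]; simp only [pol]; ring

lemma B_small {t : ℝ} (h0 : 0 < t) (h1 : t < 1 / 2) :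
    (∫ s in t..1, gTri' s * gTri' (s - t)) = 1 - 3 * t := by
  rw [piece3 (b := 1 / 2) (c := t + 1 / 2) (p := pol (1) (0) (0) (0) (0) (0) (0))
    (q := pol (-1) (0) (0) (0) (0) (0) (0))
    (r := pol (1) (0) (0) (0) (0) (0) (0)) (by linarith) (by linarith) (by linarith)
    (pol_cont _ _ _ _ _ _ _) (pol_cont _ _ _ _ _ _ _) (pol_cont _ _ _ _ _ _ _)
    ?_ ?_ ?_, pol_int, pol_int, pol_int]
  · simp only [polI]; ring
  · intro s hs1 hs2
    rw [g'_left (x := s) (by linarith) (by linarith), g'_left (x := s - t) (by linarith) (by linarith)]; simp only [pol]; ring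
  · intro s hs1 hs2
    rw [g'_right (x := s) (by linarith) (by linarith), g'_left (x := s - t) (by linarith) (by linarith)]; simp only [pol]; ring
  · intro s hs1 hs2
    rw [g'_right (x := s) (by linarith) (by linarith), g'_right (x := s - t) (by linarith) (by linarith)]; simp only [pol]; ring

lemma B_large {t : ℝ} (h0 : 1 / 2 < t) (h1 : t < 1) :
    (∫ s in t..1, gTri' s * gTri' (s - t)) = -(1 - t) := by
  rw [(piece1 (p := pol (-1) (0) (0) (0) (0) (0) (0)) (by linarith)
    (pol_cont _ _ _ _ _ _ _) ?_).2, pol_int]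
  · simp only [polI]; ring
  · intro s hs1 hs2
    rw [g'_right (x := s) (by linarith) (by linarith), g'_left (x := s - t) (by linarith) (by linarith)]; simp only [pol]; ring

/-- Example 4.7 of Jacod–Podolskij–Vetter. Explicit evaluation of
`Ψ_{2-}, Ψ_{2+}, Ψ̄_{2-}, Ψ̄_{2+}` and of `μ̄₄(g,g;η,ζ)` for the triangular weight
function `g(x) = min(x, 1-x) 1_{[0,1]}(x)`. -/
theorem stmt17 :
    (∫ t in (0 : ℝ)..1, (∫ s in t..1, gTri s * gTri (s - t)) ^ 2) = 151 / 80640 ∧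
    (∫ t in (0 : ℝ)..1, (∫ s in (0 : ℝ)..(1 - t), gTri s * gTri (s + t)) ^ 2) =
      151 / 80640 ∧
    (∫ t in (0 : ℝ)..1, (∫ s in t..1, gTri s * gTri' (s - t)) ^ 2) = 1 / 96 ∧
    (∫ t in (0 : ℝ)..1, (∫ s in (0 : ℝ)..(1 - t), gTri s * gTri' (s + t)) ^ 2) = 1 / 96 ∧
    ∀ η ζ : ℝ,
      4 * ∫ s in (0 : ℝ)..1,
          (η ^ 2 * (∫ u in s..1, gTri u * gTri (u - s)) +
            ζ ^ 2 * ∫ u in s..1, gTri' u * gTri' (u - s)) ^ 2 =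
        4 * (151 / 80640 * η ^ 4 + 1 / 48 * η ^ 2 * ζ ^ 2 + 1 / 6 * ζ ^ 4) := by
  refine ⟨?_, ?_, ?_, ?_, ?_⟩
  · rw [(piece2 (b := 1 / 2) (p := pol (1/144) (0) (-1/12) (1/12) (1/4) (-1/2) (1/4))
      (q := pol (1/36) (-1/6) (5/12) (-5/9) (5/12) (-1/6) (1/36))
      (by norm_num) (by norm_num) (pol_cont _ _ _ _ _ _ _) (pol_cont _ _ _ _ _ _ _) ?_ ?_).2,
      pol_int, pol_int]
    · simp only [polI]; ring
    · intro t h0 h1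
      rw [A_small h0 h1]; simp only [pol]; ring
    · intro t h0 h1
      rw [A_large h0 h1]; simp only [pol]; ring
  · rw [(piece2 (b := 1 / 2) (p := pol (1/144) (0) (-1/12) (1/12) (1/4) (-1/2) (1/4))
      (q := pol (1/36) (-1/6) (5/12) (-5/9) (5/12) (-1/6) (1/36))
      (by norm_num) (by norm_num) (pol_cont _ _ _ _ _ _ _) (pol_cont _ _ _ _ _ _ _) ?_ ?_).2,
      pol_int, pol_int]
    · simp only [polI]; ring
    · intro t h0 h1
      rw [A2_small h0 h1]; simp only [pol]; ring
    · intro t h0 h1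
      rw [A2_large h0 h1]; simp only [pol]; ring
  · rw [(piece2 (b := 1 / 2) (p := pol (0) (0) (1) (-3) (9/4) (0) (0))
      (q := pol (1/4) (-1) (3/2) (-1) (1/4) (0) (0))
      (by norm_num) (by norm_num) (pol_cont _ _ _ _ _ _ _) (pol_cont _ _ _ _ _ _ _) ?_ ?_).2,
      pol_int, pol_int]
    · simp only [polI]; ring
    · intro t h0 h1
      rw [D_small h0 h1]; simp only [pol]; ring
    · intro t h0 h1
      rw [D_large h0 h1]; simp only [pol]; ring
  · rw [(piece2 (b := 1 / 2) (p := pol (0) (0) (1) (-3) (9/4) (0) (0))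
      (q := pol (1/4) (-1) (3/2) (-1) (1/4) (0) (0))
      (by norm_num) (by norm_num) (pol_cont _ _ _ _ _ _ _) (pol_cont _ _ _ _ _ _ _) ?_ ?_).2,
      pol_int, pol_int]
    · simp only [polI]; ring
    · intro t h0 h1
      rw [C_small h0 h1]; simp only [pol]; ring
    · intro t h0 h1
      rw [C_large h0 h1]; simp only [pol]; ring
  · intro η ζ
    congr 1
    rw [(piece2 (b := 1 / 2) (p := pol ((1/144) * η ^ 4 + (1/6) * η ^ 2 * ζ ^ 2 + (1) * ζ ^ 4) ((0) * η ^ 4 + (-1/2) * η ^ 2 * ζ ^ 2 + (-6) * ζ ^ 4) ((-1/12) * η ^ 4 + (-1) * η ^ 2 * ζ ^ 2 + (9) * ζ ^ 4) ((1/12) * η ^ 4 + (4) * η ^ 2 * ζ ^ 2 + (0) * ζ ^ 4) ((1/4) * η ^ 4 + (-3) * η ^ 2 * ζ ^ 2 + (0) * ζ ^ 4) ((-1/2) * η ^ 4 + (0) * η ^ 2 * ζ ^ 2 + (0) * ζ ^ 4) ((1/4) * η ^ 4 + (0) * η ^ 2 * ζ ^ 2 + (0) * ζ ^ 4))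
      (q := pol ((1/36) * η ^ 4 + (-1/3) * η ^ 2 * ζ ^ 2 + (1) * ζ ^ 4) ((-1/6) * η ^ 4 + (4/3) * η ^ 2 * ζ ^ 2 + (-2) * ζ ^ 4) ((5/12) * η ^ 4 + (-2) * η ^ 2 * ζ ^ 2 + (1) * ζ ^ 4) ((-5/9) * η ^ 4 + (4/3) * η ^ 2 * ζ ^ 2 + (0) * ζ ^ 4) ((5/12) * η ^ 4 + (-1/3) * η ^ 2 * ζ ^ 2 + (0) * ζ ^ 4) ((-1/6) * η ^ 4 + (0) * η ^ 2 * ζ ^ 2 + (0) * ζ ^ 4) ((1/36) * η ^ 4 + (0) * η ^ 2 * ζ ^ 2 + (0) * ζ ^ 4))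
      (by norm_num) (by norm_num) (pol_cont _ _ _ _ _ _ _) (pol_cont _ _ _ _ _ _ _) ?_ ?_).2,
      pol_int, pol_int]
    · simp only [polI]; ring
    · intro t h0 h1
      rw [A_small h0 h1, B_small h0 h1]; simp only [pol]; ring
    · intro t h0 h1
      rw [A_large h0 h1, B_large h0 h1]; simp only [pol]; ring
end
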